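/- Let α > 0, β ≥ 1 and p ≥ β. Let Λ be a quasi-lacunary sequence and μ a positive Borel measure on [0,1]. Suppose the inclusion ı_μ is of restricted weak type p with a uniform constant: there is C > 0 such that μ({t ∈ [0,1] : |f(t)| > λ}) ≤ C^p λ^{−p} ‖f‖^p_{L^{p/β}(dν_{α−1})} for every k, every f ∈ F_k and every λ > 0. Then for every r > p the inclusion ı_μ is of strong type r: there is a constant C_r such that ‖f‖_{L^r(dμ)} ≤ C_r ‖f‖_{L^{r/β}(dν_{α−1})} for all f ∈ M_Λ. -/

import Mathlib

open MeasureTheory Set Filter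

/-- The weighted measure `dν_{α-1} = (1-x)^{α-1} dx` on `[0,1]`. -/
noncomputable def nuMeas (α : ℝ) : MeasureTheory.Measure ℝ :=
  (MeasureTheory.volume.restrict (Set.Icc (0:ℝ) 1)).withDensity
    fun x => ENNReal.ofReal ((1 - x) ^ (α - 1))

/-- The space of Müntz polynomials `t ↦ ∑_{k=0}^K a_k t^{λ_k}`. -/
def MuntzPoly (Λ : ℕ → ℝ) : Set (ℝ → ℂ) :=
  { f | ∃ K : ℕ, ∃ a : ℕ → ℂ,
      f = fun t : ℝ => ∑ k ∈ Finset.range (K + 1), a k * ((t ^ (Λ k) : ℝ) : ℂ) }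

/-- The block space `F_k = Span{t^λ : λ ∈ E_k}`, where the `k`-th block consists of the
indices `j` with `n k ≤ j < n (k+1)`. -/
def BlockSpace (Λ : ℕ → ℝ) (n : ℕ → ℕ) (k : ℕ) : Set (ℝ → ℂ) :=
  { f | ∃ a : ℕ → ℂ,
      f = fun t : ℝ => ∑ j ∈ Finset.Ico (n k) (n (k + 1)), a j * ((t ^ (Λ j) : ℝ) : ℂ) }

/-- `Λ` is a quasi-lacunary sequence: an increasing positive sequence with summable
inverses, partitioned into consecutive blocks of length at most `N` (block `k` being the
indices in `[n k, n (k+1))`), whose block endpoints form an (eventually) lacunary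
sequence. -/
structure IsQuasiLacunary (Λ : ℕ → ℝ) (n : ℕ → ℕ) (N : ℕ) : Prop where
  pos : ∀ k, 0 < Λ k
  mono : StrictMono Λ
  sum_inv : Summable fun k => 1 / Λ k
  one_le_N : 1 ≤ N
  n_zero : n 0 = 0
  n_mono : StrictMono n
  block_le : ∀ k, n (k + 1) - n k ≤ N
  ratio : ∃ q : ℝ, 1 < q ∧ ∀ᶠ k in Filter.atTop, q * Λ (n k) < Λ (n (k + 1))

/-- The block endpoints of `Λ` form a subgeometric sequence. -/
def IsSubgeometric (Λ : ℕ → ℝ) (n : ℕ → ℕ) : Prop :=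
  ∃ q' : ℝ, 1 < q' ∧ ∀ᶠ k in Filter.atTop, Λ (n (k + 1)) ≤ q' * Λ (n k)

/-- `T` is a sublinear operator acting on `M_Λ`, producing `μ`-measurable functions. -/
def SublinearOn (Λ : ℕ → ℝ) (μ : MeasureTheory.Measure ℝ)
    (T : (ℝ → ℂ) → ℝ → ℂ) : Prop :=
  (∀ f ∈ MuntzPoly Λ, AEMeasurable (T f) μ) ∧
  (∀ c : ℂ, ∀ f ∈ MuntzPoly Λ, ∀ t : ℝ, ‖T (fun x => c * f x) t‖ = ‖c‖ * ‖T f t‖) ∧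
  (∀ f ∈ MuntzPoly Λ, ∀ g ∈ MuntzPoly Λ, ∀ t : ℝ,
      ‖T (f + g) t‖ ≤ ‖T f t‖ + ‖T g t‖) ∧
  (∀ f ∈ MuntzPoly Λ, ∀ g ∈ MuntzPoly Λ, ∀ t : ℝ,
      ‖T f t - T g t‖ ≤ ‖T (f - g) t‖)

/-- `T` is of restricted weak type `r` with constants `Cr k`:
`μ(|Tf| > λ) ≤ Cr(k)^r λ^{-r} ‖f‖^r_{L^{r/β}(dν_{α-1})}` for every `f ∈ F_k`, `λ > 0`. -/
def RestrictedWeakType (Λ : ℕ → ℝ) (n : ℕ → ℕ) (α β : ℝ)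
    (μ : MeasureTheory.Measure ℝ) (T : (ℝ → ℂ) → ℝ → ℂ) (r : ℝ) (Cr : ℕ → ℝ) : Prop :=
  ∀ k : ℕ, ∀ f ∈ BlockSpace Λ n k, ∀ lam : ℝ, 0 < lam →
    μ {t : ℝ | lam < ‖T f t‖} ≤
      ENNReal.ofReal (Cr k ^ r * lam⁻¹ ^ r) *
        MeasureTheory.eLpNorm f (ENNReal.ofReal (r / β)) (nuMeas α) ^ r

/-- `T` is of restricted strong type `r` with constants `Cr k`:
`‖Tf‖_{L^r(dμ)} ≤ Cr(k) ‖f‖_{L^{r/β}(dν_{α-1})}` for every `f ∈ F_k`. -/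
def RestrictedStrongType (Λ : ℕ → ℝ) (n : ℕ → ℕ) (α β : ℝ)
    (μ : MeasureTheory.Measure ℝ) (T : (ℝ → ℂ) → ℝ → ℂ) (r : ℝ) (Cr : ℕ → ℝ) : Prop :=
  ∀ k : ℕ, ∀ f ∈ BlockSpace Λ n k,
    MeasureTheory.eLpNorm (T f) (ENNReal.ofReal r) μ ≤
      ENNReal.ofReal (Cr k) *
        MeasureTheory.eLpNorm f (ENNReal.ofReal (r / β)) (nuMeas α)

/-- The condition `B_{p,Λ}(α,β)`: `sup_k λ_{n_k}^{αβ} ∫ t^{p λ_{n_k}} dμ < ∞`. -/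
def CondB (Λ : ℕ → ℝ) (n : ℕ → ℕ) (α β p : ℝ) (μ : MeasureTheory.Measure ℝ) : Prop :=
  ∃ B : ℝ, ∀ k : ℕ,
    ENNReal.ofReal (Λ (n k) ^ (α * β)) *
        ∫⁻ t in Set.Icc (0:ℝ) 1, ENNReal.ofReal (t ^ (p * Λ (n k))) ∂μ ≤
      ENNReal.ofReal B

/-- The condition `A_{p,Λ}(α,β)`:
`∑_k λ_{n_k}^{αβ/(1-β)} (∫ t^{p λ_{n_k}} dμ)^{1/(1-β)} < ∞`. -/
def CondA (Λ : ℕ → ℝ) (n : ℕ → ℕ) (α β p : ℝ) (μ : MeasureTheory.Measure ℝ) : Prop :=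
  (∑' k : ℕ, ENNReal.ofReal (Λ (n k) ^ (α * β / (1 - β))) *
      (∫⁻ t in Set.Icc (0:ℝ) 1, ENNReal.ofReal (t ^ (p * Λ (n k))) ∂μ) ^ (1 / (1 - β))) < ⊤

/-- The image under `T` of the unit ball of `M_Λ` (with the `L^{r/β}(dν_{α-1})` norm)
is totally bounded in `L^r(dμ)`. -/
def CompactEmbed (Λ : ℕ → ℝ) (α β r : ℝ) (μ : MeasureTheory.Measure ℝ)
    (T : (ℝ → ℂ) → ℝ → ℂ) : Prop :=
  ∀ δ : ℝ, 0 < δ → ∃ G : Set (ℝ → ℂ), G.Finite ∧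
    ∀ f ∈ MuntzPoly Λ,
      MeasureTheory.eLpNorm f (ENNReal.ofReal (r / β)) (nuMeas α) ≤ 1 →
      ∃ g ∈ G, MeasureTheory.eLpNorm (fun t => T f t - g t) (ENNReal.ofReal r) μ <
        ENNReal.ofReal δ


noncomputable def ES (s : Finset ℕ) (L : ℕ → ℝ) (a : ℕ → ℂ) (x : ℝ) : ℂ :=
  ∑ i ∈ s, a i * ((Real.exp (-(L i) * x) : ℝ) : ℂ)

lemma ES_cont (s : Finset ℕ) (L : ℕ → ℝ) (a : ℕ → ℂ) : Continuous (ES s L a) := by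
  unfold ES; fun_prop

lemma ES_shift (s : Finset ℕ) (L : ℕ → ℝ) (a : ℕ → ℂ) (x h : ℝ) :
    ES s L a (x + h) = ES s L (fun i => a i * ((Real.exp (-(L i) * h) : ℝ) : ℂ)) x := by
  unfold ES
  refine Finset.sum_congr rfl fun i _ => ?_
  rw [mul_add, Real.exp_add]; push_cast; ring

lemma ES_kill (s : Finset ℕ) (L : ℕ → ℝ) (a : ℕ → ℂ) (x h m : ℝ) :
    ES s L (fun i => a i * ((Real.exp (-(L i) * h) - Real.exp (-m * h) : ℝ) : ℂ)) x =
      ES s L a (x + h) - ((Real.exp (-m * h) : ℝ) : ℂ) * ES s L a x := by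
  rw [ES_shift]
  unfold ES
  rw [Finset.mul_sum, ← Finset.sum_sub_distrib]
  refine Finset.sum_congr rfl fun i _ => ?_
  push_cast; ring

lemma ES_weight (s : Finset ℕ) (L : ℕ → ℝ) (a : ℕ → ℂ) (x c : ℝ) :
    ES s (fun i => L i - c) a x = ((Real.exp (c * x) : ℝ) : ℂ) * ES s L a x := by
  unfold ES
  rw [Finset.mul_sum]
  refine Finset.sum_congr rfl fun i _ => ?_
  rw [show -(L i - c) * x = c * x + -(L i) * x by ring, Real.exp_add]; push_cast; ring

lemma ES_weight_norm (s : Finset ℕ) (L : ℕ → ℝ) (a : ℕ → ℂ) (x c : ℝ) :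
    ‖ES s (fun i => L i - c) a x‖ = Real.exp (c * x) * ‖ES s L a x‖ := by
  rw [ES_weight, norm_mul, Complex.norm_real, Real.norm_eq_abs, abs_of_pos (Real.exp_pos _)]

lemma ES_neg (s : Finset ℕ) (L : ℕ → ℝ) (a : ℕ → ℂ) (x : ℝ) :
    ES s (fun i => - L i) a x = ES s L a (-x) := by
  unfold ES
  refine Finset.sum_congr rfl fun i _ => ?_
  congr 3; ring

lemma ES_scale (s : Finset ℕ) (L : ℕ → ℝ) (a : ℕ → ℂ) (x c : ℝ) :
    ES s (fun i => L i * c) a x = ES s L a (c * x) := by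
  unfold ES
  refine Finset.sum_congr rfl fun i _ => ?_
  congr 3; ring

/-- killing the exponent of index `i0`. -/
lemma ES_insert_kill (s : Finset ℕ) (i0 : ℕ) (hi : i0 ∉ s) (L : ℕ → ℝ) (a : ℕ → ℂ) (x h : ℝ) :
    ES s L (fun i => a i * ((Real.exp (-(L i) * h) - Real.exp (-(L i0) * h) : ℝ) : ℂ)) x =
      ES (insert i0 s) L a (x + h) - ((Real.exp (-(L i0) * h) : ℝ) : ℂ) * ES (insert i0 s) L a x := by
  rw [← ES_kill]
  unfold ES
  rw [Finset.sum_insert hi]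
  simp

lemma norm_exp_le_one (m h : ℝ) (hm : 0 ≤ m) (hh : 0 ≤ h) :
    ‖((Real.exp (-m * h) : ℝ) : ℂ)‖ ≤ 1 := by
  rw [Complex.norm_real, Real.norm_eq_abs, abs_of_pos (Real.exp_pos _)]
  apply Real.exp_le_one_iff.2
  nlinarith [mul_nonneg hm hh]

lemma past_avg (s : Finset ℕ) (L : ℕ → ℝ) :
    (∀ i ∈ s, 0 ≤ L i) → ∀ (a : ℕ → ℂ) (l y : ℝ), 0 < l →
      ‖ES s L a y‖ * l ≤ 3 ^ s.card * ∫ x in (y - 2 * s.card * l)..y, ‖ES s L a x‖ := by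
  induction s using Finset.induction_on with
  | empty => intro _ a l y hl; simp [ES]
  | insert i0 s hi ih =>
    intro hL a l y hl
    rw [Finset.card_insert_of_notMem hi]
    set f := ES (insert i0 s) L a with hf
    have hfc : Continuous f := ES_cont _ _ _
    have hnc : Continuous (fun x => ‖f x‖) := hfc.norm
    set M : ℕ := s.card
    have hM0 : (0:ℝ) ≤ M := Nat.cast_nonneg _
    set I := ∫ x in (y - 2 * ((M + 1 : ℕ):ℝ) * l)..y, ‖f x‖ with hI
    have hL0 := hL i0 (Finset.mem_insert_self _ _)
    have hLs : ∀ i ∈ s, 0 ≤ L i := fun i h => hL i (Finset.mem_insert_of_mem h)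
    have ii : ∀ u v : ℝ, IntervalIntegrable (fun x => ‖f x‖) volume u v :=
      fun u v => hnc.intervalIntegrable _ _
    have sub : ∀ u v : ℝ, y - 2 * ((M + 1 : ℕ):ℝ) * l ≤ u → u ≤ v → v ≤ y →
        ∫ x in u..v, ‖f x‖ ≤ I := by
      intro u v h1 h2 h3
      apply intervalIntegral.integral_mono_interval h1 h2 h3
      · exact Eventually.of_forall fun x => norm_nonneg _
      · exact ii _ _
    push_cast at sub
    have key : ∀ h ∈ Icc l (2 * l), ‖f y‖ * l ≤ ‖f (y - h)‖ * l + 3 ^ M * (2 * I) := by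
      intro h hh
      have hh0 : 0 ≤ h := hl.le.trans hh.1
      set b : ℕ → ℂ := fun i => a i * ((Real.exp (-(L i) * h) - Real.exp (-(L i0) * h) : ℝ) : ℂ)
      have hb : ∀ x, ES s L b x = f (x + h) - ((Real.exp (-(L i0) * h) : ℝ) : ℂ) * f x :=
        fun x => ES_insert_kill s i0 hi L a x h
      have hbn : ∀ x, ‖ES s L b x‖ ≤ ‖f (x + h)‖ + ‖f x‖ := by
        intro x
        rw [hb]
        refine (norm_sub_le _ _).trans ?_
        rw [norm_mul]
        have := norm_exp_le_one (L i0) h hL0 hh0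
        nlinarith [norm_nonneg (f x)]
      have h1 := ih hLs b l (y - h) hl
      have h2 : ∫ x in (y - h - 2 * (M:ℝ) * l)..(y - h), ‖ES s L b x‖ ≤ 2 * I := by
        calc _ ≤ ∫ x in (y - h - 2 * (M:ℝ) * l)..(y - h), (‖f (x + h)‖ + ‖f x‖) := by
              apply intervalIntegral.integral_mono_on (by nlinarith)
              · exact (ES_cont _ _ _).norm.intervalIntegrable _ _
              · apply Continuous.intervalIntegrable; fun_prop
              · intro x _; exact hbn x
          _ = (∫ x in (y - 2 * (M:ℝ) * l)..y, ‖f x‖)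
                + ∫ x in (y - h - 2 * (M:ℝ) * l)..(y - h), ‖f x‖ := by
              rw [intervalIntegral.integral_add]
              · rw [intervalIntegral.integral_comp_add_right (fun x => ‖f x‖)]
                congr 2 <;> ring
              · apply Continuous.intervalIntegrable; fun_prop
              · exact ii _ _
          _ ≤ I + I := by
              apply add_le_add
              · apply sub <;> nlinarith
              · apply sub <;> nlinarith [hh.1, hh.2]
          _ = 2 * I := by ring
      have h3 : ‖f y‖ ≤ ‖f (y - h)‖ + ‖ES s L b (y - h)‖ := by
        have := hb (y - h)
        rw [sub_add_cancel] at this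
        have e : f y = ES s L b (y - h) + ((Real.exp (-(L i0) * h) : ℝ) : ℂ) * f (y - h) := by
          rw [this]; ring
        rw [e]
        refine (norm_add_le _ _).trans ?_
        rw [norm_mul]
        have := norm_exp_le_one (L i0) h hL0 hh0
        nlinarith [norm_nonneg (f (y - h))]
      have h4 : (3:ℝ) ^ M * ∫ x in (y - h - 2 * (M:ℝ) * l)..(y - h), ‖ES s L b x‖ ≤ 3 ^ M * (2 * I) :=
        mul_le_mul_of_nonneg_left h2 (by positivity)
      nlinarith
    have h5 : ∫ _ in l..(2*l), ‖f y‖ * l ≤ ∫ h in l..(2*l), (‖f (y - h)‖ * l + 3 ^ M * (2 * I)) := by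
      apply intervalIntegral.integral_mono_on (by linarith)
      · exact intervalIntegrable_const
      · apply Continuous.intervalIntegrable; fun_prop
      · intro h hh; exact key h hh
    rw [intervalIntegral.integral_const, intervalIntegral.integral_add
      (by apply Continuous.intervalIntegrable; fun_prop) intervalIntegrable_const,
      intervalIntegral.integral_const, intervalIntegral.integral_mul_const,
      intervalIntegral.integral_comp_sub_left (fun x => ‖f x‖)] at h5
    have h6 : ∫ x in (y - 2 * l)..(y - l), ‖f x‖ ≤ I := by
      apply sub <;> nlinarith
    have h7 : (1:ℝ) ≤ 3 ^ M := one_le_pow₀ (by norm_num)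
    have hI0 : 0 ≤ I := by
      apply intervalIntegral.integral_nonneg
      · push_cast; nlinarith
      · intro x _; exact norm_nonneg _
    simp only [smul_eq_mul] at h5
    rw [show 2 * l - l = l by ring] at h5
    have h8 : ‖f y‖ * l * l ≤ (3 ^ (M+1) * I) * l := by
      have : (3:ℝ)^(M+1) = 3 * 3^M := by ring
      rw [this]
      nlinarith [mul_nonneg hI0 hl.le, mul_nonneg (sub_nonneg.2 h7) (mul_nonneg hI0 hl.le)]
    exact le_of_mul_le_mul_right h8 hl

lemma past_avg' (s : Finset ℕ) (L : ℕ → ℝ) (M : ℕ) (hM : s.card ≤ M)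
    (hL : ∀ i ∈ s, 0 ≤ L i) (a : ℕ → ℂ) (l y : ℝ) (hl : 0 < l) :
      ‖ES s L a y‖ * l ≤ 3 ^ M * ∫ x in (y - 2 * M * l)..y, ‖ES s L a x‖ := by
  have hM' : (s.card : ℝ) ≤ M := by exact_mod_cast hM
  have h0 : (0:ℝ) ≤ s.card := by positivity
  refine (past_avg s L hL a l y hl).trans ?_
  apply mul_le_mul
  · exact pow_le_pow_right₀ (by norm_num) hM
  · apply intervalIntegral.integral_mono_interval (by nlinarith) (by nlinarith) le_rfl
    · exact Eventually.of_forall fun x => norm_nonneg _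
    · exact (ES_cont _ _ _).norm.intervalIntegrable _ _
  · apply intervalIntegral.integral_nonneg (by nlinarith)
    intro x _; exact norm_nonneg _
  · positivity

lemma future_avg' (s : Finset ℕ) (L : ℕ → ℝ) (M : ℕ) (hM : s.card ≤ M)
    (hL : ∀ i ∈ s, L i ≤ 0) (a : ℕ → ℂ) (l y : ℝ) (hl : 0 < l) :
      ‖ES s L a y‖ * l ≤ 3 ^ M * ∫ x in y..(y + 2 * M * l), ‖ES s L a x‖ := by
  have := past_avg' s (fun i => - L i) M hM (fun i hi => by linarith [hL i hi]) a l (-y) hl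
  simp only [ES_neg, neg_neg] at this
  rw [intervalIntegral.integral_comp_neg (fun x => ‖ES s L a x‖), neg_neg] at this
  convert this using 3
  ring

lemma ES_hasDeriv (s : Finset ℕ) (L : ℕ → ℝ) (a : ℕ → ℂ) (x : ℝ) :
    HasDerivAt (ES s L a) (ES s L (fun i => a i * ((-(L i) : ℝ) : ℂ)) x) x := by
  unfold ES
  apply HasDerivAt.fun_sum
  intro i _
  have h1 : HasDerivAt (fun x : ℝ => Real.exp (-(L i) * x)) (Real.exp (-(L i) * x) * (-(L i))) x := by
    simpa using (((hasDerivAt_id x).const_mul (-(L i))).exp)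
  have h2 := (h1.ofReal_comp).const_mul (a i)
  refine h2.congr_deriv ?_
  push_cast; ring

lemma ES_bernstein (s : Finset ℕ) (L : ℕ → ℝ) :
    (∀ i ∈ s, 0 ≤ L i) → ∀ (a : ℕ → ℂ) (l y A : ℝ), 0 < l →
      (∀ x ∈ Icc (y - 2 * s.card * l) y, ‖ES s L a x‖ ≤ A) →
      ‖ES s L (fun i => a i * ((-(L i) : ℝ) : ℂ)) y‖ * l ≤ 5 ^ s.card * A := by
  induction s using Finset.induction_on with
  | empty =>
    intro _ a l y A hl h
    have := h y (by simp)
    simpa [ES] using this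
  | insert i0 s hi ih =>
    intro hL a l y A hl hA
    rw [Finset.card_insert_of_notMem hi] at hA ⊢
    set f := ES (insert i0 s) L a with hf
    set f' := ES (insert i0 s) L (fun i => a i * ((-(L i) : ℝ) : ℂ)) with hf'
    have hd : ∀ x, HasDerivAt f (f' x) x := ES_hasDeriv _ _ _
    set M : ℕ := s.card
    have hM0 : (0:ℝ) ≤ M := Nat.cast_nonneg _
    have hL0 := hL i0 (Finset.mem_insert_self _ _)
    have hLs : ∀ i ∈ s, 0 ≤ L i := fun i h => hL i (Finset.mem_insert_of_mem h)
    push_cast at hA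
    have hA0 : 0 ≤ A := (norm_nonneg _).trans (hA y ⟨by nlinarith, le_rfl⟩)
    set c := L i0
    set φ : ℝ → ℂ := fun h => (h:ℂ) * f' y + ((Real.exp (-c * h) : ℝ) : ℂ) * f (y - h) with hφ
    set g : ℝ → ℂ := fun h => f' y - ((Real.exp (-c * h) : ℝ) : ℂ) * f' (y - h) with hg
    have hφd : ∀ h, HasDerivAt φ (g h - ((c * Real.exp (-c * h) : ℝ) : ℂ) * f (y - h)) h := by
      intro h
      have h1 : HasDerivAt (fun x : ℝ => Real.exp (-c * x)) (Real.exp (-c * h) * (-c)) h := by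
        simpa using (((hasDerivAt_id h).const_mul (-c)).exp)
      have h2 : HasDerivAt (fun h => f (y - h)) (- f' (y - h)) h := by
        have := (hd (y - h)).scomp h ((hasDerivAt_id h).const_sub y)
        simpa [Function.comp_def] using this
      have h3 : HasDerivAt (fun h : ℝ => (h:ℂ) * f' y) (1 * f' y) h :=
        ((hasDerivAt_id h).ofReal_comp).mul_const _
      refine (h3.add (h1.ofReal_comp.mul h2)).congr_deriv ?_
      simp only [hg]
      push_cast; ring
    have hgb : ∀ h ∈ Icc l (2*l), ‖g h‖ * l ≤ 5 ^ M * (2 * A) := by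
      intro h hh
      have hh0 : 0 ≤ h := hl.le.trans hh.1
      set b : ℕ → ℂ := fun i => a i * ((Real.exp (-(L i) * h) - Real.exp (-c * h) : ℝ) : ℂ)
      have hb : ∀ x, ES s L b x = f (x + h) - ((Real.exp (-c * h) : ℝ) : ℂ) * f x :=
        fun x => ES_insert_kill s i0 hi L a x h
      have h1 := ih hLs b l (y - h) (2 * A) hl (by
        intro x hx
        rw [hb]
        refine (norm_sub_le _ _).trans ?_
        rw [norm_mul]
        have := norm_exp_le_one c h hL0 hh0
        have e1 := hA (x + h) ⟨by nlinarith [hx.1], by linarith [hx.2]⟩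
        have e2 := hA x ⟨by nlinarith [hx.1, hh.2], by linarith [hx.2]⟩
        nlinarith [norm_nonneg (f x)])
      convert h1 using 3
      have := ES_insert_kill s i0 hi L (fun i => a i * ((-(L i) : ℝ) : ℂ)) (y - h) h
      rw [sub_add_cancel] at this
      simp only [hg, hf']
      rw [← this]
      unfold ES
      refine Finset.sum_congr rfl fun i _ => ?_
      simp only [b]; push_cast; ring
    have hbd : ∀ h ∈ Icc l (2*l),
        ‖g h - ((c * Real.exp (-c * h) : ℝ) : ℂ) * f (y - h)‖ ≤ (5 ^ M * (2 * A) + A) / l := by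
      intro h hh
      have hh0 : 0 ≤ h := hl.le.trans hh.1
      rw [le_div_iff₀ hl]
      have e0 := hgb h hh
      have e1 := hA (y - h) ⟨by nlinarith [hh.1, hh.2], by linarith [hh.1, hh.2]⟩
      have e2 : ‖((c * Real.exp (-c * h) : ℝ) : ℂ)‖ * l ≤ 1 := by
        rw [Complex.norm_real, Real.norm_eq_abs, abs_of_nonneg (by positivity)]
        have : c * h * Real.exp (-(c * h)) ≤ 1 := by
          have := Real.add_one_le_exp (c * h)
          rw [Real.exp_neg, ← div_eq_mul_inv, div_le_one (Real.exp_pos _)]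
          linarith
        rw [neg_mul]
        have h3 : 0 ≤ c * Real.exp (-(c*h)) := by positivity
        nlinarith [hh.1]
      have e3 := norm_sub_le (g h) (((c * Real.exp (-c * h) : ℝ) : ℂ) * f (y - h))
      rw [norm_mul] at e3
      have e4 := norm_nonneg (f (y - h))
      have e5 := norm_nonneg ((c * Real.exp (-c * h) : ℝ) : ℂ)
      calc _ ≤ (‖g h‖ + ‖((c * Real.exp (-c * h) : ℝ) : ℂ)‖ * ‖f (y - h)‖) * l :=
            mul_le_mul_of_nonneg_right e3 hl.le
        _ = ‖g h‖ * l + (‖((c * Real.exp (-c * h) : ℝ) : ℂ)‖ * l) * ‖f (y - h)‖ := by ring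
        _ ≤ 5 ^ M * (2 * A) + 1 * A := by
            apply add_le_add e0
            exact mul_le_mul e2 e1 e4 zero_le_one
        _ = _ := by ring
    have hmv := (convex_Icc l (2*l)).norm_image_sub_le_of_norm_hasDerivWithin_le
      (fun h _ => (hφd h).hasDerivWithinAt) hbd (left_mem_Icc.2 (by linarith))
      (right_mem_Icc.2 (by linarith))
    rw [show 2 * l - l = l by ring, Real.norm_eq_abs, abs_of_pos hl, div_mul_cancel₀ _ hl.ne'] at hmv
    have e1 := hA (y - l) ⟨by nlinarith, by linarith⟩
    have e2 := hA (y - 2*l) ⟨by nlinarith, by linarith⟩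
    have n1 := norm_exp_le_one c l hL0 hl.le
    have n2 := norm_exp_le_one c (2*l) hL0 (by linarith)
    have e3 : (l:ℂ) * f' y = (φ (2*l) - φ l) - ((Real.exp (-c * (2*l)) : ℝ) : ℂ) * f (y - 2*l)
        + ((Real.exp (-c * l) : ℝ) : ℂ) * f (y - l) := by
      simp only [hφ]; push_cast; ring
    have e4 : ‖f' y‖ * l = ‖(l:ℂ) * f' y‖ := by
      rw [norm_mul, Complex.norm_real, Real.norm_eq_abs, abs_of_pos hl, mul_comm]
    rw [e4, e3]
    have m1 : ‖((Real.exp (-c * (2*l)) : ℝ) : ℂ) * f (y - 2*l)‖ ≤ 1 * A := by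
      rw [norm_mul]; exact mul_le_mul n2 e2 (norm_nonneg _) zero_le_one
    have m2 : ‖((Real.exp (-c * l) : ℝ) : ℂ) * f (y - l)‖ ≤ 1 * A := by
      rw [norm_mul]; exact mul_le_mul n1 e1 (norm_nonneg _) zero_le_one
    refine (norm_add_le _ _).trans ?_
    have m3 := norm_sub_le (φ (2*l) - φ l) (((Real.exp (-c * (2*l)) : ℝ) : ℂ) * f (y - 2*l))
    have h7 : (1:ℝ) ≤ 5 ^ M := one_le_pow₀ (by norm_num)
    have : (5:ℝ)^(M+1) = 5 * 5^M := by ring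
    rw [this]
    nlinarith [mul_nonneg (sub_nonneg.2 h7) hA0]


noncomputable def Wt (u v x : ℝ) : ℝ := max (Real.exp (-u * x)) (Real.exp (-v * x))

lemma Wt_pos (u v x : ℝ) : 0 < Wt u v x := lt_max_of_lt_left (Real.exp_pos _)

lemma Wt_add (u v x y : ℝ) : Wt u v (x + y) ≤ Wt u v x * Wt u v y := by
  unfold Wt
  apply max_le
  · rw [mul_add, Real.exp_add]
    exact mul_le_mul (le_max_left _ _) (le_max_left _ _) (Real.exp_pos _).le (Wt_pos u v x).le
  · rw [mul_add, Real.exp_add]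
    exact mul_le_mul (le_max_right _ _) (le_max_right _ _) (Real.exp_pos _).le (Wt_pos u v x).le

lemma Wt_anti (u v : ℝ) (hu : 0 ≤ u) (hv : 0 ≤ v) {x y : ℝ} (h : x ≤ y) : Wt u v y ≤ Wt u v x := by
  unfold Wt
  apply max_le_max <;> apply Real.exp_le_exp.2 <;> nlinarith

lemma Wt_of_nonneg (u v x : ℝ) (huv : u ≤ v) (hx : 0 ≤ x) : Wt u v x = Real.exp (-u * x) := by
  unfold Wt
  apply max_eq_left; apply Real.exp_le_exp.2; nlinarith

lemma Wt_of_nonpos (u v x : ℝ) (huv : u ≤ v) (hx : x ≤ 0) : Wt u v x = Real.exp (-v * x) := by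
  unfold Wt
  apply max_eq_right; apply Real.exp_le_exp.2; nlinarith

lemma Wt_scale (u v c x : ℝ) : Wt u v (c * x) = Wt (u * c) (v * c) x := by
  unfold Wt; congr 2 <;> ring

lemma ES_bdd (s : Finset ℕ) (L : ℕ → ℝ) (a : ℕ → ℂ) (u v : ℝ)
    (hL : ∀ i ∈ s, u ≤ L i ∧ L i ≤ v) : ∃ P : ℝ, 0 ≤ P ∧ ∀ x, ‖ES s L a x‖ ≤ P * Wt u v x := by
  refine ⟨∑ i ∈ s, ‖a i‖, by positivity, fun x => ?_⟩
  unfold ES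
  refine (norm_sum_le _ _).trans ?_
  rw [Finset.sum_mul]
  refine Finset.sum_le_sum fun i hi => ?_
  rw [norm_mul, Complex.norm_real, Real.norm_eq_abs, abs_of_pos (Real.exp_pos _)]
  apply mul_le_mul_of_nonneg_left _ (norm_nonneg _)
  rcases le_total 0 x with hx | hx
  · refine le_trans ?_ (le_max_left _ _)
    apply Real.exp_le_exp.2; nlinarith [(hL i hi).1]
  · refine le_trans ?_ (le_max_right _ _)
    apply Real.exp_le_exp.2; nlinarith [(hL i hi).2]

/-- least weighted bound -/
lemma exists_least (f : ℝ → ℂ) (W : ℝ → ℝ) (hW : ∀ x, 0 < W x) (P0 : ℝ)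
    (h0 : ∀ x, ‖f x‖ ≤ P0 * W x) :
    ∃ P : ℝ, 0 ≤ P ∧ (∀ x, ‖f x‖ ≤ P * W x) ∧ ∀ G, (∀ x, ‖f x‖ ≤ G * W x) → P ≤ G := by
  have hb : BddAbove (range fun x => ‖f x‖ / W x) := by
    refine ⟨P0, ?_⟩
    rintro _ ⟨x, rfl⟩
    exact (div_le_iff₀ (hW x)).2 (h0 x)
  refine ⟨⨆ x, ‖f x‖ / W x, ?_, ?_, ?_⟩
  · exact Real.iSup_nonneg fun x => div_nonneg (norm_nonneg _) (hW x).le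
  · intro x
    exact (div_le_iff₀ (hW x)).1 (le_ciSup hb x)
  · intro G hG
    exact ciSup_le fun x => (div_le_iff₀ (hW x)).2 (hG x)

lemma absorb (f : ℝ → ℂ) (W : ℝ → ℝ) (hW : ∀ x, 0 < W x) (P0 : ℝ)
    (h0 : ∀ x, ‖f x‖ ≤ P0 * W x) (ρ K : ℝ) (hρ : ρ < 1)
    (h : ∀ P, 0 ≤ P → (∀ x, ‖f x‖ ≤ P * W x) → ∀ x, ‖f x‖ ≤ (ρ * P + K) * W x) :
    ∀ x, ‖f x‖ ≤ K / (1 - ρ) * W x := by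
  obtain ⟨P, hP, h1, h2⟩ := exists_least f W hW P0 h0
  have h3 := h2 _ (h P hP h1)
  intro x
  refine (h1 x).trans (mul_le_mul_of_nonneg_right ?_ (hW x).le)
  rw [le_div_iff₀ (by linarith)]
  linarith

lemma exp_int_le (d y z : ℝ) (hd : 0 < d) :
    ∫ x in z..y, Real.exp (d * x) ≤ Real.exp (d * y) / d := by
  rw [intervalIntegral.integral_comp_mul_left (fun x => Real.exp x) hd.ne', integral_exp,
    smul_eq_mul, div_eq_inv_mul]
  apply mul_le_mul_of_nonneg_left _ (by positivity)
  linarith [Real.exp_pos (d * z)]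

lemma exp_int_le' (d y z : ℝ) (hd : 0 < d) :
    ∫ x in y..z, Real.exp (-d * x) ≤ Real.exp (-d * y) / d := by
  have := exp_int_le d (-y) (-z) hd
  rw [← intervalIntegral.integral_comp_neg] at this
  simpa using this

lemma block_unit0 (M : ℕ) (κ : ℝ) (hκ : 1 < κ) :
    ∃ C T : ℝ, 0 < C ∧ 0 ≤ T ∧ ∀ (s : Finset ℕ) (L : ℕ → ℝ) (a : ℕ → ℂ) (θ : ℝ),
      s.card ≤ M → 1 ≤ θ → (∀ i ∈ s, 1 ≤ L i ∧ L i ≤ θ) →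
      ∀ x, ‖ES s L a x‖ ≤ C * (∫ y in (-(2*T))..T, ‖ES s L a y‖) * Wt κ⁻¹ (κ * θ) x := by
  have hκ0 : 0 < κ := by linarith
  set u := κ⁻¹ with hu
  have hu1 : u < 1 := inv_lt_one_of_one_lt₀ hκ
  have hu0 : 0 < u := inv_pos.2 hκ0
  have hδ : 1 - u ≤ κ - 1 := by
    have : u * κ = 1 := inv_mul_cancel₀ hκ0.ne'
    nlinarith
  have h3 : (0:ℝ) < 3 ^ M := by positivity
  set l : ℝ := 2 * 3 ^ M / (1 - u) with hl
  have hl0 : 0 < l := div_pos (by positivity) (by linarith)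
  have hl1 : l * (1 - u) = 2 * 3 ^ M := div_mul_cancel₀ _ (by linarith)
  set T : ℝ := 2 * M * l with hT
  have hT0 : 0 ≤ T := by positivity
  refine ⟨2 * (3 ^ M / l * Real.exp T), T, by positivity, hT0, ?_⟩
  intro s L a θ hM hθ hL
  set v := κ * θ with hv
  have hvθ : θ + (1 - u) ≤ v := by nlinarith
  have huv : u ≤ v := by linarith
  set f := ES s L a with hf
  have hfc : Continuous f := ES_cont _ _ _
  obtain ⟨P0, -, hP0⟩ := ES_bdd s L a u v (fun i hi => ⟨by linarith [(hL i hi).1], by linarith [(hL i hi).2]⟩)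
  set I := ∫ y in (-(2*T))..T, ‖f y‖ with hI
  have hI0 : 0 ≤ I := intervalIntegral.integral_nonneg (by linarith) fun x _ => norm_nonneg _
  have main := absorb f (Wt u v) (Wt_pos u v) P0 hP0 (1/2) (3 ^ M / l * Real.exp T * I) (by norm_num) ?_
  · intro x
    refine (main x).trans (le_of_eq ?_)
    ring
  intro P hP hb y
  have hK0 : 0 ≤ 3 ^ M / l * Real.exp T * I := by positivity
  rcases le_total T y with hy | hy
  · -- large y
    have hy0 : 0 ≤ y := hT0.trans hy
    have h1 := past_avg' s (fun i => L i - 1) M hM (fun i hi => by linarith [(hL i hi).1]) a l y hl0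
    simp only [ES_weight_norm] at h1
    have h2 : ∫ x in (y - 2 * M * l)..y, Real.exp (1 * x) * ‖ES s L a x‖ ≤
        ∫ x in (y - 2 * M * l)..y, P * Real.exp ((1 - u) * x) := by
      apply intervalIntegral.integral_mono_on (by linarith)
      · apply Continuous.intervalIntegrable
        exact (by fun_prop : Continuous fun x:ℝ => Real.exp (1 * x)).mul hfc.norm
      · apply Continuous.intervalIntegrable; fun_prop
      · intro x hx
        have := hb x
        rw [Wt_of_nonneg u v x huv (by linarith [hx.1])] at this
        calc _ ≤ Real.exp (1 * x) * (P * Real.exp (-u * x)) :=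
              mul_le_mul_of_nonneg_left this (Real.exp_pos _).le
          _ = P * (Real.exp (1 * x) * Real.exp (-u * x)) := by ring
          _ = _ := by rw [← Real.exp_add]; congr 2; ring
    rw [intervalIntegral.integral_const_mul] at h2
    have h4 := exp_int_le (1 - u) y (y - 2 * M * l) (by linarith)
    have h5 : Real.exp (1 * y) * ‖f y‖ * l ≤ 3 ^ M * (P * (Real.exp ((1 - u) * y) / (1 - u))) :=
      h1.trans (mul_le_mul_of_nonneg_left (h2.trans (mul_le_mul_of_nonneg_left h4 hP)) h3.le)
    rw [Wt_of_nonneg u v y huv hy0]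
    have h6 : ‖f y‖ ≤ 1/2 * P * Real.exp (-u * y) := by
      have e1 : Real.exp ((1 - u) * y) = Real.exp (1 * y) * Real.exp (-u * y) := by
        rw [← Real.exp_add]; congr 1; ring
      rw [e1] at h5
      have e2 : 3 ^ M * (P * (Real.exp (1 * y) * Real.exp (-u * y) / (1 - u)))
          = Real.exp (1 * y) * (1/2 * P * Real.exp (-u * y)) * l := by
        have : (3:ℝ) ^ M = l * (1 - u) / 2 := by linarith
        rw [this]
        have : 1 - u ≠ 0 := by linarith
        field_simp
      rw [e2] at h5
      have h7 := le_of_mul_le_mul_right h5 hl0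
      exact le_of_mul_le_mul_left h7 (Real.exp_pos _)
    refine h6.trans (mul_le_mul_of_nonneg_right (by linarith) (Real.exp_pos _).le)
  rcases le_total y (-T) with hy' | hy'
  · have hy0 : y ≤ 0 := by linarith
    have h1 := future_avg' s (fun i => L i - θ) M hM (fun i hi => by linarith [(hL i hi).2]) a l y hl0
    simp only [ES_weight_norm] at h1
    have h2 : ∫ x in y..(y + 2 * M * l), Real.exp (θ * x) * ‖ES s L a x‖ ≤
        ∫ x in y..(y + 2 * M * l), P * Real.exp (-(v - θ) * x) := by
      apply intervalIntegral.integral_mono_on (by linarith)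
      · apply Continuous.intervalIntegrable
        exact (by fun_prop : Continuous fun x:ℝ => Real.exp (θ * x)).mul hfc.norm
      · apply Continuous.intervalIntegrable; fun_prop
      · intro x hx
        have := hb x
        rw [Wt_of_nonpos u v x huv (by linarith [hx.2])] at this
        calc _ ≤ Real.exp (θ * x) * (P * Real.exp (-v * x)) :=
              mul_le_mul_of_nonneg_left this (Real.exp_pos _).le
          _ = P * (Real.exp (θ * x) * Real.exp (-v * x)) := by ring
          _ = _ := by rw [← Real.exp_add]; congr 2; ring
    rw [intervalIntegral.integral_const_mul] at h2
    have h4 := exp_int_le' (v - θ) y (y + 2 * M * l) (by linarith)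
    have h4' : Real.exp (-(v - θ) * y) / (v - θ) ≤ Real.exp (-(v - θ) * y) / (1 - u) :=
      div_le_div_of_nonneg_left (Real.exp_pos _).le (by linarith) (by linarith)
    have h5 : Real.exp (θ * y) * ‖f y‖ * l ≤ 3 ^ M * (P * (Real.exp (-(v - θ) * y) / (1 - u))) :=
      h1.trans (mul_le_mul_of_nonneg_left (h2.trans (mul_le_mul_of_nonneg_left (h4.trans h4') hP)) h3.le)
    rw [Wt_of_nonpos u v y huv hy0]
    have h6 : ‖f y‖ ≤ 1/2 * P * Real.exp (-v * y) := by
      have e1 : Real.exp (-(v - θ) * y) = Real.exp (θ * y) * Real.exp (-v * y) := by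
        rw [← Real.exp_add]; congr 1; ring
      rw [e1] at h5
      have e2 : 3 ^ M * (P * (Real.exp (θ * y) * Real.exp (-v * y) / (1 - u)))
          = Real.exp (θ * y) * (1/2 * P * Real.exp (-v * y)) * l := by
        have : (3:ℝ) ^ M = l * (1 - u) / 2 := by linarith
        rw [this]
        have : 1 - u ≠ 0 := by linarith
        field_simp
      rw [e2] at h5
      have h7 := le_of_mul_le_mul_right h5 hl0
      exact le_of_mul_le_mul_left h7 (Real.exp_pos _)
    refine h6.trans (mul_le_mul_of_nonneg_right (by linarith) (Real.exp_pos _).le)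
  · have h1 := past_avg' s L M hM (fun i hi => by linarith [(hL i hi).1]) a l y hl0
    have h2 : ∫ x in (y - 2 * M * l)..y, ‖ES s L a x‖ ≤ I := by
      apply intervalIntegral.integral_mono_interval (by linarith) (by linarith) hy
      · exact Eventually.of_forall fun x => norm_nonneg _
      · exact hfc.norm.intervalIntegrable _ _
    have h4 : ‖f y‖ ≤ 3 ^ M / l * I := by
      rw [div_mul_eq_mul_div, le_div_iff₀ hl0]
      exact h1.trans (mul_le_mul_of_nonneg_left h2 h3.le)
    have h5 : Real.exp (-T) ≤ Wt u v y := by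
      refine le_trans ?_ (le_max_left _ _)
      apply Real.exp_le_exp.2
      nlinarith
    calc ‖f y‖ ≤ 3 ^ M / l * I := h4
      _ = (3 ^ M / l * Real.exp T * I) * Real.exp (-T) := by
          rw [Real.exp_neg]; field_simp
      _ ≤ (3 ^ M / l * Real.exp T * I) * Wt u v y := mul_le_mul_of_nonneg_left h5 hK0
      _ ≤ _ := mul_le_mul_of_nonneg_right (by linarith) (Wt_pos _ _ _).le

lemma block_unit (M : ℕ) (κ Q : ℝ) (hκ : 1 < κ) (hQ : 1 ≤ Q) :
    ∃ C T : ℝ, 0 < C ∧ 1 < T ∧ ∀ (s : Finset ℕ) (L : ℕ → ℝ) (a : ℕ → ℂ) (θ : ℝ),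
      s.card ≤ M → 1 ≤ θ → θ ≤ Q → (∀ i ∈ s, 1 ≤ L i ∧ L i ≤ θ) →
      ∀ x, ‖ES s L a x‖ ≤ C * (∫ y in (1:ℝ)..T, ‖ES s L a y‖) * Wt κ⁻¹ (κ * θ) x := by
  obtain ⟨C, T, hC, hT, H⟩ := block_unit0 M κ hκ
  refine ⟨C * Real.exp (κ * Q * (2 * T + 1)), 3 * T + 2, by positivity, by linarith, ?_⟩
  intro s L a θ hM h1 hQ' hL x
  set c := 2 * T + 1 with hc
  have := H s L (fun i => a i * ((Real.exp (-(L i) * c) : ℝ) : ℂ)) θ hM h1 hL (x - c)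
  simp only [← ES_shift, sub_add_cancel] at this
  rw [intervalIntegral.integral_comp_add_right (fun y => ‖ES s L a y‖)] at this
  have hI : ∫ y in (-(2*T) + c)..(T + c), ‖ES s L a y‖ ≤ ∫ y in (1:ℝ)..(3 * T + 2), ‖ES s L a y‖ := by
    apply intervalIntegral.integral_mono_interval (by linarith) (by linarith) (by linarith)
    · exact Eventually.of_forall fun x => norm_nonneg _
    · exact (ES_cont _ _ _).norm.intervalIntegrable _ _
  have hI0 : 0 ≤ ∫ y in (1:ℝ)..(3 * T + 2), ‖ES s L a y‖ :=
    intervalIntegral.integral_nonneg (by linarith) fun x _ => norm_nonneg _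
  have hu : κ⁻¹ ≤ κ * θ := by
    have : κ⁻¹ < 1 := inv_lt_one_of_one_lt₀ hκ
    nlinarith
  have hW : Wt κ⁻¹ (κ * θ) (x - c) ≤ Wt κ⁻¹ (κ * θ) x * Real.exp (κ * Q * (2 * T + 1)) := by
    have h := Wt_add κ⁻¹ (κ * θ) x (-c)
    rw [Wt_of_nonpos _ _ (-c) hu (by linarith), ← sub_eq_add_neg] at h
    refine h.trans (mul_le_mul_of_nonneg_left ?_ (Wt_pos _ _ _).le)
    apply Real.exp_le_exp.2
    have : κ * θ ≤ κ * Q := by nlinarith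
    nlinarith
  calc _ ≤ _ := this
    _ ≤ C * (∫ y in (1:ℝ)..(3 * T + 2), ‖ES s L a y‖) *
        (Wt κ⁻¹ (κ * θ) x * Real.exp (κ * Q * (2 * T + 1))) := by
        apply mul_le_mul _ hW (Wt_pos _ _ _).le (by positivity)
        exact mul_le_mul_of_nonneg_left hI hC.le
    _ = _ := by ring

lemma block_scaled (M : ℕ) (κ Q : ℝ) (hκ : 1 < κ) (hQ : 1 ≤ Q) :
    ∃ C T : ℝ, 0 < C ∧ 1 < T ∧ ∀ (s : Finset ℕ) (L : ℕ → ℝ) (a : ℕ → ℂ) (m θ : ℝ),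
      s.card ≤ M → 0 < m → m ≤ θ → θ ≤ Q * m → (∀ i ∈ s, m ≤ L i ∧ L i ≤ θ) →
      ∀ x, ‖ES s L a x‖ ≤ C * (m * ∫ y in (1/m)..(T/m), ‖ES s L a y‖) * Wt (m / κ) (κ * θ) x := by
  obtain ⟨C, T, hC, hT, H⟩ := block_unit M κ Q hκ hQ
  refine ⟨C, T, hC, hT, ?_⟩
  intro s L a m θ hM hm h1 hQ' hL x
  have := H s (fun i => L i * m⁻¹) a (θ * m⁻¹) hM
    (by rw [← div_eq_mul_inv, le_div_iff₀ hm]; linarith)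
    (by rw [← div_eq_mul_inv, div_le_iff₀ hm]; linarith)
    (fun i hi => ⟨by rw [← div_eq_mul_inv, le_div_iff₀ hm]; linarith [(hL i hi).1],
      mul_le_mul_of_nonneg_right (hL i hi).2 (by positivity)⟩) (m * x)
  simp only [ES_scale] at this
  rw [inv_mul_cancel_left₀ hm.ne', Wt_scale,
    intervalIntegral.integral_comp_mul_left (fun y => ‖ES s L a y‖) (by positivity)] at this
  convert this using 3
  · rw [smul_eq_mul, inv_inv]; congr 2 <;> field_simp
  · field_simp
  · field_simp


noncomputable def kmul (l : List ℝ) (h x : ℝ) : ℝ :=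
  (l.map fun m => Real.exp (-x * h) - Real.exp (-m * h)).prod

noncomputable def kcoef (l : List ℝ) (h : ℝ) (L : ℕ → ℝ) (a : ℕ → ℂ) : ℕ → ℂ :=
  fun i => a i * ((kmul l h (L i) : ℝ) : ℂ)

lemma kcoef_nil (h : ℝ) (L : ℕ → ℝ) (a : ℕ → ℂ) : kcoef [] h L a = a := by
  funext i; simp [kcoef, kmul]

lemma ES_kcoef_cons (s : Finset ℕ) (m : ℝ) (l : List ℝ) (h : ℝ) (L : ℕ → ℝ) (a : ℕ → ℂ) (x : ℝ) :
    ES s L (kcoef (m :: l) h L a) x = ES s L (kcoef l h L a) (x + h)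
      - ((Real.exp (-m * h) : ℝ) : ℂ) * ES s L (kcoef l h L a) x := by
  rw [← ES_kill]
  congr 1
  funext i
  simp only [kcoef, kmul, List.map_cons, List.prod_cons]
  push_cast; ring

lemma kcoef_append (l l' : List ℝ) (h : ℝ) (L : ℕ → ℝ) (a : ℕ → ℂ) :
    kcoef (l ++ l') h L a = kcoef l h L (kcoef l' h L a) := by
  funext i
  simp only [kcoef, kmul, List.map_append, List.prod_append]
  push_cast; ring

lemma ES_kcoef_zero (s : Finset ℕ) (l : List ℝ) (h : ℝ) (L : ℕ → ℝ) (a : ℕ → ℂ)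
    (hs : ∀ i ∈ s, L i ∈ l) (x : ℝ) : ES s L (kcoef l h L a) x = 0 := by
  unfold ES
  refine Finset.sum_eq_zero fun i hi => ?_
  have : kmul l h (L i) = 0 := by
    unfold kmul
    apply List.prod_eq_zero
    rw [List.mem_map]
    exact ⟨L i, hs i hi, sub_self _⟩
  simp [kcoef, this]

lemma kill_up (s : Finset ℕ) (L : ℕ → ℝ) (a : ℕ → ℂ) (u v h A : ℝ) (hu : 0 ≤ u) (hv : 0 ≤ v)
    (hh : 0 ≤ h) (hA : ∀ x, ‖ES s L a x‖ ≤ A * Wt u v x) (l : List ℝ) (hl : ∀ m ∈ l, 0 ≤ m) :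
    ∀ x, ‖ES s L (kcoef l h L a) x‖ ≤ 2 ^ l.length * A * Wt u v x := by
  have hA0 : 0 ≤ A := by
    have := (norm_nonneg _).trans (hA 0)
    exact nonneg_of_mul_nonneg_left this (Wt_pos _ _ _)
  induction l with
  | nil => intro x; rw [kcoef_nil]; simpa using hA x
  | cons m l ih =>
    intro x
    have ih' := ih fun m hm => hl m (List.mem_cons_of_mem _ hm)
    rw [ES_kcoef_cons]
    refine (norm_sub_le _ _).trans ?_
    rw [norm_mul]
    have h1 := norm_exp_le_one m h (hl m List.mem_cons_self) hh
    have h2 := ih' x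
    have h3 := ih' (x + h)
    have h4 := Wt_anti u v hu hv (by linarith : x ≤ x + h)
    have h5 : 2 ^ l.length * A * Wt u v (x + h) ≤ 2 ^ l.length * A * Wt u v x :=
      mul_le_mul_of_nonneg_left h4 (by positivity)
    rw [List.length_cons, pow_succ]
    nlinarith [norm_nonneg (ES s L (kcoef l h L a) x)]

lemma kill_inv (s : Finset ℕ) (L : ℕ → ℝ) (a : ℕ → ℂ) (u v h d m G : ℝ) (huv : u ≤ v)
    (hh : 0 < h) (hd : 0 < d) (hL : ∀ i ∈ s, u ≤ L i ∧ L i ≤ v) (hm : m + d ≤ u ∨ v + d ≤ m)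
    (hG : ∀ x, ‖ES s L a (x + h) - ((Real.exp (-m * h) : ℝ) : ℂ) * ES s L a x‖ ≤ G * Wt u v x) :
    ∀ x, ‖ES s L a x‖ ≤ Real.exp (v * h) / (1 - Real.exp (-d * h)) * G * Wt u v x := by
  set f := ES s L a with hf
  obtain ⟨P0, -, hP0⟩ := ES_bdd s L a u v hL
  have hG0 : 0 ≤ G := by
    have := (norm_nonneg _).trans (hG 0)
    exact nonneg_of_mul_nonneg_left this (Wt_pos _ _ _)
  have key := absorb f (Wt u v) (Wt_pos u v) P0 hP0 (Real.exp (-d * h)) (Real.exp (v * h) * G)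
    (by rw [Real.exp_lt_one_iff]; nlinarith) ?_
  · intro x
    refine (key x).trans (le_of_eq ?_)
    ring
  intro P hP hb x
  have hW := Wt_pos u v x
  rcases hm with hm | hm
  · have e : f x = ((Real.exp (m * h) : ℝ) : ℂ) *
        (f (x + h) - (f (x + h) - ((Real.exp (-m * h) : ℝ) : ℂ) * f x)) := by
      rw [sub_sub_cancel, ← mul_assoc, ← Complex.ofReal_mul, ← Real.exp_add]
      simp
    rw [e, norm_mul, Complex.norm_real, Real.norm_eq_abs, abs_of_pos (Real.exp_pos _)]
    have h1 := norm_sub_le (f (x + h)) (f (x + h) - ((Real.exp (-m * h) : ℝ) : ℂ) * f x)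
    have h2 := hb (x + h)
    have h3 := hG x
    have h4 := Wt_add u v x h
    rw [Wt_of_nonneg u v h huv hh.le] at h4
    have h5 : ‖f (x + h) - (f (x + h) - ((Real.exp (-m * h) : ℝ) : ℂ) * f x)‖ ≤
        P * (Wt u v x * Real.exp (-u * h)) + G * Wt u v x :=
      h1.trans (add_le_add (h2.trans (mul_le_mul_of_nonneg_left h4 hP)) h3)
    refine (mul_le_mul_of_nonneg_left h5 (Real.exp_pos _).le).trans ?_
    have h6 : Real.exp (m * h) * Real.exp (-u * h) ≤ Real.exp (-d * h) := by
      rw [← Real.exp_add]; apply Real.exp_le_exp.2; nlinarith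
    have h7 : Real.exp (m * h) ≤ Real.exp (v * h) := by
      apply Real.exp_le_exp.2; nlinarith
    calc _ = (Real.exp (m * h) * Real.exp (-u * h)) * (P * Wt u v x) + Real.exp (m * h) * (G * Wt u v x) := by ring
      _ ≤ Real.exp (-d * h) * (P * Wt u v x) + Real.exp (v * h) * (G * Wt u v x) := by gcongr
      _ = _ := by ring
  · have e : f x = ((Real.exp (-m * h) : ℝ) : ℂ) * f (x - h)
        + (f (x - h + h) - ((Real.exp (-m * h) : ℝ) : ℂ) * f (x - h)) := by
      rw [sub_add_cancel]; ring
    rw [e]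
    refine (norm_add_le _ _).trans ?_
    rw [norm_mul, Complex.norm_real, Real.norm_eq_abs, abs_of_pos (Real.exp_pos _)]
    have h4 := Wt_add u v x (-h)
    rw [Wt_of_nonpos u v (-h) huv (by linarith), ← sub_eq_add_neg, neg_mul_neg] at h4
    have h2 := (hb (x - h)).trans (mul_le_mul_of_nonneg_left h4 hP)
    have h3 := (hG (x - h)).trans (mul_le_mul_of_nonneg_left h4 hG0)
    have h6 : Real.exp (-m * h) * Real.exp (v * h) ≤ Real.exp (-d * h) := by
      rw [← Real.exp_add]; apply Real.exp_le_exp.2; nlinarith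
    calc _ ≤ Real.exp (-m * h) * (P * (Wt u v x * Real.exp (v * h))) + G * (Wt u v x * Real.exp (v * h)) := by
          gcongr
      _ = (Real.exp (-m * h) * Real.exp (v * h)) * (P * Wt u v x) + Real.exp (v * h) * G * Wt u v x := by ring
      _ ≤ Real.exp (-d * h) * (P * Wt u v x) + Real.exp (v * h) * G * Wt u v x := by gcongr
      _ = _ := by ring

lemma kill_inv_list (s : Finset ℕ) (L : ℕ → ℝ) (u v h d : ℝ) (huv : u ≤ v)
    (hh : 0 < h) (hd : 0 < d) (hL : ∀ i ∈ s, u ≤ L i ∧ L i ≤ v) (l : List ℝ)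
    (hl : ∀ m ∈ l, m + d ≤ u ∨ v + d ≤ m) : ∀ (a : ℕ → ℂ) (G : ℝ),
    (∀ x, ‖ES s L (kcoef l h L a) x‖ ≤ G * Wt u v x) →
    ∀ x, ‖ES s L a x‖ ≤ (Real.exp (v * h) / (1 - Real.exp (-d * h))) ^ l.length * G * Wt u v x := by
  induction l with
  | nil => intro a G hG x; rw [kcoef_nil] at hG; simpa using hG x
  | cons m l ih =>
    intro a G hG
    simp only [ES_kcoef_cons] at hG
    have h1 := kill_inv s L (kcoef l h L a) u v h d m G huv hh hd hL (hl m List.mem_cons_self) hG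
    have h2 := ih (fun m hm => hl m (List.mem_cons_of_mem _ hm)) a _ h1
    intro x
    refine (h2 x).trans (le_of_eq ?_)
    rw [List.length_cons, pow_succ]; ring

lemma kill_int (s : Finset ℕ) (L : ℕ → ℝ) (a : ℕ → ℂ) (h : ℝ) (hh : 0 ≤ h) (l : List ℝ)
    (hl : ∀ m ∈ l, 0 ≤ m) : ∀ (y z : ℝ), y ≤ z →
    ∫ x in y..z, ‖ES s L (kcoef l h L a) x‖ ≤ 2 ^ l.length * ∫ x in y..(z + l.length * h), ‖ES s L a x‖ := by
  induction l with
  | nil => intro y z _; simp [kcoef_nil]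
  | cons m l ih =>
    intro y z hyz
    have ih' := ih fun m hm => hl m (List.mem_cons_of_mem _ hm)
    have hc := (ES_cont s L (kcoef l h L a)).norm
    have hc2 : Continuous (fun x => ‖ES s L (kcoef l h L a) (x + h)‖) :=
      hc.comp (continuous_add_const h)
    have h1 : ∫ x in y..z, ‖ES s L (kcoef (m :: l) h L a) x‖ ≤
        ∫ x in y..z, (‖ES s L (kcoef l h L a) (x + h)‖ + ‖ES s L (kcoef l h L a) x‖) := by
      apply intervalIntegral.integral_mono_on hyz
      · exact (ES_cont _ _ _).norm.intervalIntegrable _ _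
      · apply Continuous.intervalIntegrable
        exact hc2.add hc
      · intro x _
        rw [ES_kcoef_cons]
        refine (norm_sub_le _ _).trans ?_
        rw [norm_mul]
        have h1 := norm_exp_le_one m h (hl m List.mem_cons_self) hh
        nlinarith [norm_nonneg (ES s L (kcoef l h L a) x)]
    rw [intervalIntegral.integral_add
      (hc2.intervalIntegrable _ _) (hc.intervalIntegrable _ _),
      intervalIntegral.integral_comp_add_right (fun x => ‖ES s L (kcoef l h L a) x‖)] at h1
    have mono : ∀ p q, y ≤ p → p ≤ q → q ≤ z + h →
        ∫ x in p..q, ‖ES s L (kcoef l h L a) x‖ ≤ ∫ x in y..(z+h), ‖ES s L (kcoef l h L a) x‖ := by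
      intro p q h1 h2 h3
      apply intervalIntegral.integral_mono_interval h1 h2 h3
      · exact Eventually.of_forall fun x => norm_nonneg _
      · exact hc.intervalIntegrable _ _
    have h2 := mono (y + h) (z + h) (by linarith) (by linarith) le_rfl
    have h3 := mono y z le_rfl hyz (by linarith)
    have h4 := ih' y (z + h) (by linarith)
    have e : z + h + l.length * h = z + ((m :: l).length : ℕ) * h := by
      rw [List.length_cons]; push_cast; ring
    rw [e] at h4
    rw [List.length_cons, pow_succ] at *
    nlinarith

lemma kill_low1 (s : Finset ℕ) (L : ℕ → ℝ) (a : ℕ → ℂ) (M : ℕ) (κ Q m θ h A : ℝ) (hκ : 1 < κ)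
    (hM : s.card ≤ M) (hm : 0 < m) (hmθ : m ≤ θ) (hθ : θ ≤ Q * m) (hL : ∀ i ∈ s, m ≤ L i ∧ L i ≤ θ)
    (hh : 0 ≤ h) (hA : ∀ x, ‖ES s L a x‖ ≤ A * Wt (m / κ) (κ * θ) x) :
    ∀ x, ‖ES s L a (x + h) - ES s L a x‖ ≤
      (5 ^ M * Real.exp (2 * M * κ * Q) * (m * h)) * A * Wt (m / κ) (κ * θ) x := by
  intro x
  have hA0 : 0 ≤ A := by
    have := (norm_nonneg _).trans (hA 0)
    exact nonneg_of_mul_nonneg_left this (Wt_pos _ _ _)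
  have hκ0 : 0 < κ := by linarith
  have hu : 0 ≤ m / κ := by positivity
  have hv : 0 ≤ κ * θ := by nlinarith
  have huv : m / κ ≤ κ * θ := by
    rw [div_le_iff₀ hκ0]; nlinarith [mul_pos hκ0 hm]
  have hM' : (s.card : ℝ) ≤ M := by exact_mod_cast hM
  have hs0 : (0:ℝ) ≤ s.card := Nat.cast_nonneg _
  set W := Wt (m / κ) (κ * θ)
  set B := 5 ^ M * Real.exp (2 * M * κ * Q) * m * A * W x
  have hder : ∀ y ∈ Icc x (x + h), ‖ES s L (fun i => a i * ((-(L i) : ℝ) : ℂ)) y‖ ≤ B := by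
    intro y hy
    have h1 := ES_bernstein s L (fun i hi => by linarith [(hL i hi).1]) a (1/m) y
      (A * (W x * Real.exp (2 * M * κ * Q))) (by positivity) (by
        intro z hz
        refine (hA z).trans (mul_le_mul_of_nonneg_left ?_ hA0)
        have h2 : x + -(2 * M * (1/m)) ≤ z := by
          have : 2 * (s.card:ℝ) * (1/m) ≤ 2 * M * (1/m) := by gcongr
          linarith [hz.1, hy.1]
        refine (Wt_anti _ _ hu hv h2).trans ((Wt_add _ _ _ _).trans ?_)
        refine mul_le_mul_of_nonneg_left ?_ (Wt_pos _ _ _).le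
        rw [Wt_of_nonpos _ _ _ huv (by rw [neg_nonpos]; positivity)]
        apply Real.exp_le_exp.2
        rw [neg_mul_neg]
        have : κ * θ * (2 * M * (1/m)) = 2 * M * κ * (θ / m) := by ring
        rw [this]
        have : θ / m ≤ Q := by rw [div_le_iff₀ hm]; exact hθ
        gcongr)
    have h2 : (5:ℝ) ^ s.card ≤ 5 ^ M := pow_le_pow_right₀ (by norm_num) hM
    have hWp : 0 < W x := Wt_pos _ _ _
    have h3 : (5:ℝ) ^ s.card * (A * (W x * Real.exp (2 * M * κ * Q))) ≤
        5 ^ M * (A * (W x * Real.exp (2 * M * κ * Q))) := by gcongr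
    have h4 := h1.trans h3
    rw [mul_one_div, div_le_iff₀ hm] at h4
    refine h4.trans (le_of_eq ?_)
    simp only [B]; ring
  have := (convex_Icc x (x + h)).norm_image_sub_le_of_norm_hasDerivWithin_le
    (fun y _ => (ES_hasDeriv s L a y).hasDerivWithinAt) hder (left_mem_Icc.2 (by linarith))
      (right_mem_Icc.2 (by linarith))
  rw [add_sub_cancel_left, Real.norm_eq_abs, abs_of_nonneg hh] at this
  refine this.trans (le_of_eq ?_)
  simp only [B]; ring

lemma kill_low (s : Finset ℕ) (L : ℕ → ℝ) (a : ℕ → ℂ) (M : ℕ) (κ Q m θ h A : ℝ) (hκ : 1 < κ)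
    (hM : s.card ≤ M) (hm : 0 < m) (hmθ : m ≤ θ) (hθ : θ ≤ Q * m) (hL : ∀ i ∈ s, m ≤ L i ∧ L i ≤ θ)
    (hh : 0 ≤ h) (hA : ∀ x, ‖ES s L a x‖ ≤ A * Wt (m / κ) (κ * θ) x) (D : ℕ) :
    ∀ x, ‖ES s L (kcoef (List.replicate D 0) h L a) x‖ ≤
      (5 ^ M * Real.exp (2 * M * κ * Q) * (m * h)) ^ D * A * Wt (m / κ) (κ * θ) x := by
  induction D with
  | zero => intro x; simpa [kcoef_nil] using hA x
  | succ D ih =>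
    intro x
    rw [List.replicate_succ, ES_kcoef_cons]
    have := kill_low1 s L _ M κ Q m θ h _ hκ hM hm hmθ hθ hL hh ih x
    rw [neg_zero, zero_mul, Real.exp_zero, Complex.ofReal_one, one_mul]
    refine this.trans (le_of_eq ?_)
    ring


lemma ql_ratio_all (Λ : ℕ → ℝ) (n : ℕ → ℕ) (hpos : ∀ k, 0 < Λ k) (hm : StrictMono Λ)
    (hn : StrictMono n) : ∀ (K : ℕ) (q : ℝ), 1 < q → (∀ k, K ≤ k → q * Λ (n k) ≤ Λ (n (k+1))) →
    ∃ q' : ℝ, 1 < q' ∧ ∀ k, q' * Λ (n k) ≤ Λ (n (k+1)) := by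
  intro K
  induction K with
  | zero => intro q hq h; exact ⟨q, hq, fun k => h k (Nat.zero_le _)⟩
  | succ K ih =>
    intro q hq h
    have h1 : Λ (n K) < Λ (n (K+1)) := hm (hn (Nat.lt_succ_self K))
    refine ih (min q (Λ (n (K+1)) / Λ (n K))) (lt_min hq ((one_lt_div (hpos _)).2 h1)) ?_
    intro k hk
    rcases hk.eq_or_lt with rfl | hk
    · calc _ ≤ Λ (n (K+1)) / Λ (n K) * Λ (n K) :=
          mul_le_mul_of_nonneg_right (min_le_right _ _) (hpos _).le
        _ = _ := div_mul_cancel₀ _ (hpos _).ne'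
    · exact (mul_le_mul_of_nonneg_right (min_le_left _ _) (hpos _).le).trans (h k hk)

lemma reblock (Λ : ℕ → ℝ) (n : ℕ → ℕ) (N : ℕ) (hQL : IsQuasiLacunary Λ n N) :
    ∃ (q Q : ℝ) (M : ℕ) (st : ℕ → ℕ), 1 < q ∧ 1 ≤ Q ∧ StrictMono st ∧ st 0 = 0 ∧
      (∀ j, st (j+1) ≤ st j + M) ∧ (∀ j, Λ (st (j+1) - 1) ≤ Q * Λ (st j)) ∧
      (∀ j, q * Λ (st (j+1) - 1) ≤ Λ (st (j+1))) := by
  obtain ⟨q0, hq0, hev⟩ := hQL.ratio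
  obtain ⟨K, hK⟩ := eventually_atTop.1 hev
  obtain ⟨q, hq, hqa⟩ := ql_ratio_all Λ n hQL.pos hQL.mono hQL.n_mono K q0 hq0
    fun k hk => (hK k hk).le
  set q1 : ℝ := q ^ ((1:ℝ) / (N + 1 : ℕ)) with hq1
  have hq1p : q1 ^ (N+1) = q := by
    rw [hq1, ← Real.rpow_natCast, ← Real.rpow_mul (by linarith)]
    rw [one_div, inv_mul_cancel₀ (by positivity), Real.rpow_one]
  have hq1' : 1 < q1 := Real.one_lt_rpow hq (by positivity)
  have hq1N : q1 ^ N < q := by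
    rw [← hq1p]; exact pow_lt_pow_right₀ hq1' (Nat.lt_succ_self N)
  have run : ∀ a i, (∀ m, a ≤ m → m < a + i → ¬ q1 * Λ m ≤ Λ (m+1)) → Λ (a + i) ≤ q1 ^ i * Λ a := by
    intro a i
    induction i with
    | zero => intro _; simp
    | succ i ih =>
      intro h
      have h1 := ih fun m hm hm' => h m hm (by omega)
      have h2 := h (a+i) (by omega) (by omega)
      push Not at h2
      rw [pow_succ]
      calc Λ (a + (i+1)) ≤ q1 * Λ (a+i) := h2.le
        _ ≤ q1 * (q1 ^ i * Λ a) := mul_le_mul_of_nonneg_left h1 (by linarith)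
        _ = _ := by ring
  have gapk : ∀ k, ∃ m, n k ≤ m ∧ m < n (k+1) ∧ q1 * Λ m ≤ Λ (m+1) := by
    intro k
    by_contra hcon
    push Not at hcon
    have hlt : n k < n (k+1) := hQL.n_mono (Nat.lt_succ_self k)
    have h1 := run (n k) (n (k+1) - n k) fun m hm hm' => not_le.2 (hcon m hm (by omega))
    rw [show n k + (n (k+1) - n k) = n (k+1) by omega] at h1
    have h2 : q1 ^ (n (k+1) - n k) ≤ q1 ^ N := pow_le_pow_right₀ hq1'.le (hQL.block_le k)
    have h3 := hqa k
    have := hQL.pos (n k)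
    nlinarith
  have gap : ∀ a, ∃ m, a ≤ m ∧ m < a + 2 * N ∧ q1 * Λ m ≤ Λ (m+1) := by
    intro a
    have hex : ∃ k, a ≤ n k := ⟨a, hQL.n_mono.id_le a⟩
    classical
    have hk := Nat.find_spec hex
    have hmin : n (Nat.find hex) ≤ a + N := by
      rcases Nat.eq_zero_or_pos (Nat.find hex) with h0 | h0
      · rw [h0, hQL.n_zero]; omega
      · have h1 := Nat.find_min hex (Nat.sub_lt h0 one_pos)
        have h2 := hQL.block_le (Nat.find hex - 1)
        rw [Nat.sub_add_cancel h0] at h2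
        omega
    obtain ⟨m, h1, h2, h3⟩ := gapk (Nat.find hex)
    have := hQL.block_le (Nat.find hex)
    exact ⟨m, by omega, by omega, h3⟩
  have gapmin : ∀ a, ∃ m, a ≤ m ∧ m < a + 2 * N ∧ q1 * Λ m ≤ Λ (m+1) ∧
      ∀ i, a ≤ i → i < m → ¬ q1 * Λ i ≤ Λ (i+1) := by
    intro a
    classical
    have hex : ∃ m, a ≤ m ∧ m < a + 2 * N ∧ q1 * Λ m ≤ Λ (m+1) := gap a
    obtain ⟨h1, h2, h3⟩ := Nat.find_spec hex
    refine ⟨Nat.find hex, h1, h2, h3, fun i hi hi' hc => Nat.find_min hex hi' ⟨hi, by omega, hc⟩⟩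
  choose g g1 g2 g3 g4 using gapmin
  set st : ℕ → ℕ := fun k => Nat.rec 0 (fun _ a => g a + 1) k with hst
  have sts : ∀ j, st (j+1) = g (st j) + 1 := fun j => rfl
  refine ⟨q1, q1 ^ (2 * N), 2 * N, st, hq1', one_le_pow₀ hq1'.le, ?_, rfl, ?_, ?_, ?_⟩
  · apply strictMono_nat_of_lt_succ
    intro j; rw [sts]; have := g1 (st j); omega
  · intro j; rw [sts]; have := g2 (st j); omega
  · intro j
    rw [sts, Nat.add_sub_cancel]
    have h1 := run (st j) (g (st j) - st j) fun m hm hm' => g4 (st j) m hm (by omega)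
    have := g1 (st j)
    have := g2 (st j)
    rw [show st j + (g (st j) - st j) = g (st j) by omega] at h1
    refine h1.trans (mul_le_mul_of_nonneg_right (pow_le_pow_right₀ hq1'.le (by omega)) (hQL.pos _).le)
  · intro j
    rw [sts, Nat.add_sub_cancel]
    exact g3 (st j)


structure BData (Λ : ℕ → ℝ) (st : ℕ → ℕ) (q Q : ℝ) (M : ℕ) : Prop where
  pos : ∀ k, 0 < Λ k
  mono : StrictMono Λ
  hq : 1 < q
  hQ : 1 ≤ Q
  st_mono : StrictMono st
  st_zero : st 0 = 0
  card : ∀ j, st (j+1) ≤ st j + M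
  top : ∀ j, Λ (st (j+1) - 1) ≤ Q * Λ (st j)
  gap : ∀ j, q * Λ (st (j+1) - 1) ≤ Λ (st (j+1))

abbrev blk (st : ℕ → ℕ) (j : ℕ) : Finset ℕ := Finset.Ico (st j) (st (j+1))

lemma BData.bounds {Λ st q Q M} (B : BData Λ st q Q M) {i j : ℕ} (hi : i ∈ blk st j) :
    Λ (st j) ≤ Λ i ∧ Λ i ≤ Λ (st (j+1) - 1) := by
  rw [Finset.mem_Ico] at hi
  exact ⟨B.mono.monotone hi.1, B.mono.monotone (by omega)⟩

lemma BData.lam_le_top {Λ st q Q M} (B : BData Λ st q Q M) (j : ℕ) :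
    Λ (st j) ≤ Λ (st (j+1) - 1) := by
  have := B.st_mono (Nat.lt_succ_self j)
  exact B.mono.monotone (by rw [Nat.succ_eq_add_one] at this; omega)

lemma BData.gap_lt {Λ st q Q M} (B : BData Λ st q Q M) {j k : ℕ} (h : j < k) :
    q * Λ (st (j+1) - 1) ≤ Λ (st k) :=
  (B.gap j).trans (B.mono.monotone (B.st_mono.monotone h))

lemma BData.growth {Λ st q Q M} (B : BData Λ st q Q M) (j i : ℕ) :
    q ^ i * Λ (st j) ≤ Λ (st (j+i)) := by
  induction i with
  | zero => simp
  | succ i ih =>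
    have h1 := B.gap (j+i)
    have h2 := B.lam_le_top (j+i)
    have := B.hq
    rw [pow_succ]
    calc q ^ i * q * Λ (st j) = q * (q ^ i * Λ (st j)) := by ring
      _ ≤ q * Λ (st (j+i)) := by gcongr
      _ ≤ q * Λ (st (j+i+1) - 1) := by gcongr
      _ ≤ _ := h1

lemma BData.st_add {Λ st q Q M} (B : BData Λ st q Q M) (j i : ℕ) :
    st (j+i) ≤ st j + i * M := by
  induction i with
  | zero => simp
  | succ i ih =>
    have := B.card (j+i)
    rw [← add_assoc, add_mul]; omega

lemma ES_blocks (Λ : ℕ → ℝ) (st : ℕ → ℕ) (hst : StrictMono st) (h0 : st 0 = 0) (a : ℕ → ℂ) (n : ℕ)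
    (x : ℝ) : ES (Finset.range (st n)) Λ a x = ∑ j ∈ Finset.range n, ES (blk st j) Λ a x := by
  induction n with
  | zero => simp [h0, ES]
  | succ n ih =>
    rw [Finset.sum_range_succ, ← ih]
    unfold ES blk
    rw [Finset.sum_range_add_sum_Ico _ (hst (Nat.lt_succ_self n)).le]

lemma div_le_mul_aux {κ m θ : ℝ} (hκ : 1 < κ) (hm : 0 < m) (h : m ≤ θ) : m / κ ≤ κ * θ :=
  (div_le_self hm.le hκ.le).trans (h.trans (le_mul_of_one_le_left (hm.le.trans h) hκ.le))

set_option maxHeartbeats 1000000 in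
lemma step {Λ st q Q M} (B : BData Λ st q Q M) (κ : ℝ) (hκ : 1 < κ) (hκq : κ ^ 2 ≤ q) :
    ∃ C9 : ℝ, 1 ≤ C9 ∧ ∀ D : ℕ, ∃ C8 : ℝ, 0 < C8 ∧ ∀ L : ℕ, ∃ C5 T2 : ℝ, 0 < C5 ∧ 1 < T2 ∧
    ∀ (n : ℕ) (a : ℕ → ℂ) (P : ℕ → ℝ), (∀ j, 0 ≤ P j) →
    (∀ j x, ‖ES (blk st j) Λ a x‖ ≤ P j * Wt (Λ (st j) / κ) (κ * Λ (st (j+1) - 1)) x) →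
    ∀ k < n, ∃ G : ℝ,
      (∀ x, ‖ES (blk st k) Λ a x‖ ≤ G * Wt (Λ (st k) / κ) (κ * Λ (st (k+1) - 1)) x) ∧
      G ≤ C5 * (Λ (st k) * ∫ x in (1 / Λ (st k))..(T2 / Λ (st k)),
            ‖ES (Finset.range (st n)) Λ a x‖)
        + C8 * C9 ^ L * (∑ j ∈ (Finset.range n).filter (fun j => j + L < k),
              (Λ (st j) / Λ (st k)) ^ D * P j
            + ∑ j ∈ (Finset.range n).filter (fun j => k + L < j),
              Real.exp (- (Λ (st j) / Λ (st k)) / κ) * P j) := by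
  obtain ⟨C, T, hC, hT, hblock⟩ := block_scaled M κ Q hκ B.hQ
  have hκ0 : 0 < κ := by linarith
  set δ : ℝ := (κ - 1) / κ ^ 2 with hδ
  have hδ0 : 0 < δ := by apply div_pos <;> [linarith; positivity]
  set C1 : ℝ := Real.exp (κ * Q) / (1 - Real.exp (-δ)) with hC1
  have he : Real.exp (-δ) < 1 := by rw [Real.exp_lt_one_iff]; linarith
  have he0 := Real.exp_pos (-δ)
  have hC1' : 1 ≤ C1 := by
    rw [hC1, le_div_iff₀ (by linarith)]
    have : 1 ≤ Real.exp (κ * Q) := Real.one_le_exp (by have := B.hQ; positivity)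
    linarith
  set C2 : ℝ := 5 ^ M * Real.exp (2 * M * κ * Q) with hC2
  have hC20 : 0 < C2 := by positivity
  refine ⟨(2 * C1) ^ (2 * M), one_le_pow₀ (by linarith), fun D => ?_⟩
  refine ⟨C1 ^ D * C * T * (C2 ^ D + 2 ^ D), by positivity, fun L => ?_⟩
  refine ⟨C1 ^ (2*M*L+D) * C * 2 ^ (2*M*L+D), T + (2*M*L+D : ℕ), by positivity,
    by have : (0:ℝ) ≤ (2*M*L+D : ℕ) := Nat.cast_nonneg _
       linarith, ?_⟩
  intro n a P hP0 hP k hk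
  set m := Λ (st k) with hm
  set θ := Λ (st (k+1) - 1) with hθ
  have hm0 : 0 < m := B.pos _
  have hmθ : m ≤ θ := B.lam_le_top k
  have hθQ : θ ≤ Q * m := B.top k
  set I : Finset ℕ := Finset.Ico (st (k - L)) (st k) ∪ Finset.Ico (st (k+1)) (st (k+1+L)) with hI
  set l1 : List ℝ := I.toList.map Λ with hl1
  have hl1len : l1.length ≤ 2*M*L := by
    rw [hl1, List.length_map, Finset.length_toList]
    refine (Finset.card_union_le _ _).trans ?_
    rw [Nat.card_Ico, Nat.card_Ico]
    have h1 := B.st_add (k+1) L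
    have h2 := B.st_add (k-L) (k - (k-L))
    rw [show k - L + (k - (k-L)) = k by omega] at h2
    have h3 : (k - (k-L)) * M ≤ L * M := Nat.mul_le_mul_right _ (by omega)
    have : 2 * M * L = L * M + L * M := by ring
    omega
  have hl1mem : ∀ m' ∈ l1, m' + δ * m ≤ m / κ ∨ κ * θ + δ * m ≤ m' := by
    intro m' hm'
    rw [hl1, List.mem_map] at hm'
    obtain ⟨i, hi, rfl⟩ := hm'
    rw [Finset.mem_toList, hI, Finset.mem_union, Finset.mem_Ico, Finset.mem_Ico] at hi
    rcases hi with hi | hi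
    · left
      have hk0 : 0 < k := by
        rcases Nat.eq_zero_or_pos k with h | h
        · rw [h, B.st_zero] at hi; omega
        · exact h
      have h1 := B.gap (k-1)
      rw [Nat.sub_add_cancel hk0] at h1
      have h2 : Λ i ≤ Λ (st k - 1) := B.mono.monotone (by omega)
      have h3 : κ ^ 2 * Λ i ≤ m := by
        have := B.pos i
        have := B.pos (st k - 1)
        have := B.hq
        nlinarith
      rw [hδ, le_div_iff₀ hκ0]
      have : (Λ i + (κ - 1) / κ^2 * m) * κ = (κ ^ 2 * Λ i + (κ - 1) * m) / κ := by field_simp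
      rw [this, div_le_iff₀ hκ0]; nlinarith
    · right
      have h1 := B.gap k
      have h2 : Λ (st (k+1)) ≤ Λ i := B.mono.monotone hi.1
      have h3 : κ ^ 2 * θ ≤ Λ i := by
        have : 0 < θ := B.pos _
        nlinarith
      have h4 : δ ≤ κ * (κ - 1) := by
        rw [hδ, div_le_iff₀ (by positivity)]
        have : 1 ≤ κ ^ 3 := one_le_pow₀ hκ.le
        nlinarith
      have : δ * m ≤ κ * (κ - 1) * θ := mul_le_mul h4 hmθ hm0.le (by nlinarith)
      nlinarith
  set l : List ℝ := l1 ++ List.replicate D 0 with hl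
  have hllen : l.length ≤ 2*M*L+D := by
    rw [hl, List.length_append, List.length_replicate]; omega
  have hlmem : ∀ m' ∈ l, m' + δ * m ≤ m / κ ∨ κ * θ + δ * m ≤ m' := by
    intro m' hm'
    rw [hl, List.mem_append] at hm'
    rcases hm' with h | h
    · exact hl1mem m' h
    · rw [(List.mem_replicate.1 h).2]
      left
      rw [hδ, le_div_iff₀ hκ0]
      have : (0 + (κ - 1) / κ^2 * m) * κ = (κ - 1) * m / κ := by field_simp; ring
      rw [this, div_le_iff₀ hκ0]; nlinarith
  have hl1nn : ∀ m' ∈ l1, 0 ≤ m' := by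
    intro m' hm'
    rw [hl1, List.mem_map] at hm'
    obtain ⟨i, -, rfl⟩ := hm'
    exact (B.pos i).le
  have hlnn : ∀ m' ∈ l, 0 ≤ m' := by
    intro m' hm'
    rw [hl, List.mem_append] at hm'
    rcases hm' with h | h
    · exact hl1nn m' h
    · rw [(List.mem_replicate.1 h).2]
  set h : ℝ := 1 / m with hh
  have hh0 : 0 < h := by positivity
  have hcard : ∀ j, (blk st j).card ≤ M := by
    intro j; rw [Nat.card_Ico]; have := B.card j; omega
  have hW1 : ∀ j x, 0 ≤ x → Wt (Λ (st j) / κ) (κ * Λ (st (j+1) - 1)) x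
      = Real.exp (-(Λ (st j) / κ) * x) := by
    intro j x hx
    exact Wt_of_nonneg _ _ _ (div_le_mul_aux hκ (B.pos _) (B.lam_le_top j)) hx
  set b := kcoef l h Λ a with hb
  set g : ℝ := m * ∫ y in (1/m)..(T/m), ‖ES (blk st k) Λ b y‖ with hg
  have h1T : 1 / m ≤ T / m := by gcongr
  have hg0 : 0 ≤ g := by
    apply mul_nonneg hm0.le
    apply intervalIntegral.integral_nonneg h1T
    intro _ _; exact norm_nonneg _
  have hUk := hblock (blk st k) Λ b m θ (hcard k) hm0 hmθ hθQ (fun i hi => B.bounds hi)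
  have huv : m / κ ≤ κ * θ := div_le_mul_aux hκ hm0 hmθ
  have hkk := kill_inv_list (blk st k) Λ (m/κ) (κ*θ) h (δ*m) huv hh0 (by positivity)
    (fun i hi => by
      have := B.bounds hi
      constructor
      · refine le_trans ?_ this.1
        exact div_le_self hm0.le hκ.le
      · refine this.2.trans ?_
        have : 0 < θ := B.pos _
        nlinarith) l hlmem a (C * g) hUk
  have hfac : Real.exp (κ * θ * h) / (1 - Real.exp (-(δ * m) * h)) ≤ C1 := by
    have e1 : -(δ * m) * h = -δ := by rw [hh]; field_simp
    have e2 : κ * θ * h ≤ κ * Q := by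
      rw [hh, mul_one_div, div_le_iff₀ hm0]; nlinarith
    rw [e1, hC1]
    apply div_le_div_of_nonneg_right (Real.exp_le_exp.2 e2) (by linarith)
  have hfac0 : 0 ≤ Real.exp (κ * θ * h) / (1 - Real.exp (-(δ * m) * h)) := by
    have e1 : -(δ * m) * h = -δ := by rw [hh]; field_simp
    rw [e1]
    exact div_nonneg (Real.exp_pos _).le (by linarith)
  have hpw : (Real.exp (κ * θ * h) / (1 - Real.exp (-(δ * m) * h))) ^ l.length ≤ C1 ^ (2*M*L+D) :=
    (pow_le_pow_left₀ hfac0 hfac _).trans (pow_le_pow_right₀ hC1' hllen)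
  refine ⟨C1 ^ (2*M*L+D) * (C * g), fun x => (hkk x).trans ?_, ?_⟩
  · have := Wt_pos (m/κ) (κ*θ) x
    have : 0 ≤ C * g := by positivity
    gcongr
  -- bound of g
  set F := (Finset.range n).filter (fun j => j + L < k) with hF
  set H := (Finset.range n).filter (fun j => k + L < j) with hH
  set S1 := ∑ j ∈ F, (Λ (st j) / m) ^ D * P j with hS1
  set S2 := ∑ j ∈ H, Real.exp (- (Λ (st j) / m) / κ) * P j with hS2
  have hS10 : 0 ≤ S1 := Finset.sum_nonneg fun j _ => mul_nonneg
    (pow_nonneg (div_nonneg (B.pos _).le hm0.le) _) (hP0 j)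
  have hS20 : 0 ≤ S2 := Finset.sum_nonneg fun j _ => mul_nonneg (Real.exp_pos _).le (hP0 j)
  have hlow : ∀ j x, 0 ≤ x → ‖ES (blk st j) Λ b x‖ ≤
      2 ^ (2*M*L) * (C2 ^ D * ((Λ (st j) / m) ^ D * P j)) := by
    intro j x hx
    have h1 := kill_low (blk st j) Λ a M κ Q (Λ (st j)) (Λ (st (j+1) - 1)) h (P j) hκ (hcard j)
      (B.pos _) (B.lam_le_top j) (B.top j) (fun i hi => B.bounds hi) hh0.le (hP j) D
    have h2 := kill_up (blk st j) Λ _ _ _ h _ (div_nonneg (B.pos (st j)).le hκ0.le)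
      (mul_nonneg hκ0.le (B.pos (st (j+1) - 1)).le) hh0.le h1 l1 hl1nn x
    rw [← kcoef_append, ← hl, ← hb, hW1 j x hx] at h2
    refine h2.trans ?_
    have e1 : Real.exp (-(Λ (st j) / κ) * x) ≤ 1 := by
      rw [Real.exp_le_one_iff]
      have := div_nonneg (B.pos (st j)).le hκ0.le
      nlinarith
    have e2 : (5 ^ M * Real.exp (2 * M * κ * Q) * (Λ (st j) * h)) ^ D * P j
        = C2 ^ D * ((Λ (st j) / m) ^ D * P j) := by
      rw [← hC2, hh, mul_one_div, mul_pow, mul_assoc]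
    rw [e2]
    have e3 : 0 ≤ C2 ^ D * ((Λ (st j) / m) ^ D * P j) := by
      have := hP0 j
      have := B.pos (st j)
      positivity
    have e4 : (2:ℝ) ^ l1.length ≤ 2 ^ (2*M*L) := pow_le_pow_right₀ (by norm_num) hl1len
    calc _ ≤ 2 ^ l1.length * (C2 ^ D * ((Λ (st j) / m) ^ D * P j)) * 1 := by gcongr
      _ ≤ _ := by rw [mul_one]; gcongr
  have hhigh : ∀ j x, 1 / m ≤ x → ‖ES (blk st j) Λ b x‖ ≤
      2 ^ (2*M*L) * (2 ^ D * (Real.exp (- (Λ (st j) / m) / κ) * P j)) := by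
    intro j x hx
    have h2 := kill_up (blk st j) Λ a _ _ h _ (div_nonneg (B.pos (st j)).le hκ0.le)
      (mul_nonneg hκ0.le (B.pos (st (j+1) - 1)).le) hh0.le (hP j) l hlnn x
    rw [← hb, hW1 j x (hh0.le.trans hx)] at h2
    refine h2.trans ?_
    have e1 : Real.exp (-(Λ (st j) / κ) * x) ≤ Real.exp (- (Λ (st j) / m) / κ) := by
      rw [Real.exp_le_exp]
      have : Λ (st j) / κ * (1 / m) ≤ Λ (st j) / κ * x :=
        mul_le_mul_of_nonneg_left hx (div_nonneg (B.pos (st j)).le hκ0.le)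
      have e : - (Λ (st j) / m) / κ = - (Λ (st j) / κ * (1 / m)) := by field_simp
      rw [e]; linarith
    have e4 : (2:ℝ) ^ l.length ≤ 2 ^ (2*M*L) * 2 ^ D := by
      rw [← pow_add]; exact pow_le_pow_right₀ (by norm_num) hllen
    have := hP0 j
    calc _ ≤ 2 ^ (2*M*L) * 2 ^ D * P j * Real.exp (- (Λ (st j) / m) / κ) := by gcongr
      _ = _ := by ring
  have hnear : ∀ j, j ≠ k → ¬ j + L < k → ¬ k + L < j → ∀ x, ES (blk st j) Λ b x = 0 := by
    intro j hj h1 h2 x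
    apply ES_kcoef_zero
    intro i hi
    rw [hl, List.mem_append]; left
    rw [hl1, List.mem_map]
    refine ⟨i, ?_, rfl⟩
    rw [Finset.mem_toList, hI, Finset.mem_union, Finset.mem_Ico, Finset.mem_Ico]
    rw [Finset.mem_Ico] at hi
    rcases lt_or_gt_of_ne hj with h3 | h3
    · left
      have := B.st_mono.monotone (show k - L ≤ j by omega)
      have := B.st_mono.monotone (show j + 1 ≤ k by omega)
      omega
    · right
      have := B.st_mono.monotone (show k + 1 ≤ j by omega)
      have := B.st_mono.monotone (show j + 1 ≤ k + 1 + L by omega)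
      omega
  set R : ℝ := 2 ^ (2*M*L) * (C2 ^ D * S1 + 2 ^ D * S2) with hR
  have hptw : ∀ x, 1 / m ≤ x → ‖ES (blk st k) Λ b x‖ ≤ ‖ES (Finset.range (st n)) Λ b x‖ + R := by
    intro x hx
    have hx0 : 0 ≤ x := hh0.le.trans hx
    have e0 := ES_blocks Λ st B.st_mono B.st_zero b n x
    rw [← Finset.add_sum_erase _ _ (Finset.mem_range.2 hk)] at e0
    have e1 : ‖∑ j ∈ (Finset.range n).erase k, ES (blk st j) Λ b x‖ ≤ R := by
      refine (norm_sum_le _ _).trans ?_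
      calc ∑ j ∈ (Finset.range n).erase k, ‖ES (blk st j) Λ b x‖
          ≤ ∑ j ∈ (Finset.range n).erase k,
            ((if j + L < k then 2 ^ (2*M*L) * (C2 ^ D * ((Λ (st j) / m) ^ D * P j)) else 0)
            + (if k + L < j then 2 ^ (2*M*L) * (2 ^ D * (Real.exp (- (Λ (st j) / m) / κ) * P j)) else 0)) := by
            apply Finset.sum_le_sum
            intro j hj
            have hjk := Finset.ne_of_mem_erase hj
            by_cases c1 : j + L < k
            · have c2 : ¬ k + L < j := by omega
              rw [if_pos c1, if_neg c2, add_zero]; exact hlow j x hx0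
            · by_cases c2 : k + L < j
              · rw [if_neg c1, if_pos c2, zero_add]; exact hhigh j x hx
              · rw [if_neg c1, if_neg c2, hnear j hjk c1 c2 x]; simp
        _ ≤ ∑ j ∈ Finset.range n,
            ((if j + L < k then 2 ^ (2*M*L) * (C2 ^ D * ((Λ (st j) / m) ^ D * P j)) else 0)
            + (if k + L < j then 2 ^ (2*M*L) * (2 ^ D * (Real.exp (- (Λ (st j) / m) / κ) * P j)) else 0)) := by
            apply Finset.sum_le_sum_of_subset_of_nonneg (Finset.erase_subset _ _)
            intro j _ _
            have := hP0 j
            have := B.pos (st j)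
            apply add_nonneg <;> split_ifs <;> positivity
        _ = R := by
            rw [Finset.sum_add_distrib, ← Finset.sum_filter, ← Finset.sum_filter, ← hF, ← hH, hR,
              hS1, hS2, mul_add, Finset.mul_sum, Finset.mul_sum, Finset.mul_sum, Finset.mul_sum]
    have e2 : ES (blk st k) Λ b x = ES (Finset.range (st n)) Λ b x
        - ∑ j ∈ (Finset.range n).erase k, ES (blk st j) Λ b x := by rw [e0]; ring
    rw [e2]
    exact (norm_sub_le _ _).trans (by linarith)
  have hIntg : ∫ y in (1/m)..(T/m), ‖ES (blk st k) Λ b y‖ ≤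
      (∫ y in (1/m)..(T/m), ‖ES (Finset.range (st n)) Λ b y‖) + (T/m - 1/m) * R := by
    have : (T/m - 1/m) * R = ∫ y in (1/m)..(T/m), R := by simp
    rw [this, ← intervalIntegral.integral_add
      ((ES_cont _ _ _).norm.intervalIntegrable _ _) (continuous_const.intervalIntegrable _ _)]
    apply intervalIntegral.integral_mono_on h1T
    · exact (ES_cont _ _ _).norm.intervalIntegrable _ _
    · exact ((ES_cont _ _ _).norm.add continuous_const).intervalIntegrable _ _
    · intro x hx; exact hptw x hx.1
  have hki := kill_int (Finset.range (st n)) Λ a h hh0.le l hlnn (1/m) (T/m) h1T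
  rw [← hb] at hki
  set J := ∫ x in (1/m)..((T + (2*M*L+D : ℕ))/m), ‖ES (Finset.range (st n)) Λ a x‖ with hJ
  have hki2 : ∫ x in (1/m)..(T/m + l.length * h), ‖ES (Finset.range (st n)) Λ a x‖ ≤ J := by
    apply intervalIntegral.integral_mono_interval le_rfl
    · have : 0 ≤ (l.length : ℝ) * h := by positivity
      linarith
    · rw [hh, mul_one_div, ← add_div]
      have : (l.length : ℝ) ≤ (2*M*L+D : ℕ) := by exact_mod_cast hllen
      gcongr
    · exact Eventually.of_forall fun x => norm_nonneg _
    · exact (ES_cont _ _ _).norm.intervalIntegrable _ _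
  have hJ0 : 0 ≤ J := by
    apply intervalIntegral.integral_nonneg
    · have : (0:ℝ) ≤ (2*M*L+D : ℕ) := Nat.cast_nonneg _
      gcongr; linarith
    · intro _ _; exact norm_nonneg _
  have hki3 : ∫ y in (1/m)..(T/m), ‖ES (Finset.range (st n)) Λ b y‖ ≤ 2 ^ (2*M*L+D) * J := by
    refine hki.trans ?_
    have : (2:ℝ) ^ l.length ≤ 2 ^ (2*M*L+D) := pow_le_pow_right₀ (by norm_num) hllen
    calc _ ≤ 2 ^ l.length * J := by gcongr
      _ ≤ _ := by gcongr
  have hR0 : 0 ≤ R := by positivity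
  have hgb : g ≤ 2 ^ (2*M*L+D) * (m * J) + T * R := by
    have : (T/m - 1/m) * R ≤ T / m * R := by
      have : 0 ≤ 1/m := hh0.le
      gcongr; linarith
    calc g ≤ m * (2 ^ (2*M*L+D) * J + T / m * R) := by
          rw [hg]; gcongr; linarith
      _ = _ := by field_simp
  calc C1 ^ (2*M*L+D) * (C * g) ≤ C1 ^ (2*M*L+D) * (C * (2 ^ (2*M*L+D) * (m * J) + T * R)) := by
        gcongr
    _ = C1 ^ (2*M*L+D) * C * 2 ^ (2*M*L+D) * (m * J) + C1 ^ (2*M*L+D) * C * T * R := by ring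
    _ ≤ _ := by
      refine add_le_add le_rfl ?_
      have e1 : C2 ^ D * S1 + 2 ^ D * S2 ≤ (C2 ^ D + 2 ^ D) * (S1 + S2) := by
        have h1 : 0 ≤ C2 ^ D * S2 := by positivity
        have h2 : 0 ≤ 2 ^ D * S1 := by positivity
        nlinarith
      have e2 : ((2 * C1) ^ (2 * M)) ^ L = 2 ^ (2*M*L) * C1 ^ (2*M*L) := by
        rw [← pow_mul, mul_pow]
      rw [e2, hR]
      calc C1 ^ (2*M*L+D) * C * T * (2 ^ (2*M*L) * (C2 ^ D * S1 + 2 ^ D * S2))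
          ≤ C1 ^ (2*M*L+D) * C * T * (2 ^ (2*M*L) * ((C2 ^ D + 2 ^ D) * (S1 + S2))) := by gcongr
        _ = _ := by rw [pow_add]; ring


abbrev dd (j k : ℕ) : ℕ := (j - k) + (k - j)

lemma sum_geo_dd (ρ : ℝ) (h0 : 0 < ρ) (h1 : ρ < 1) (k n : ℕ) :
    ∑ j ∈ Finset.range n, ρ ^ dd j k ≤ 2 / (1 - ρ) := by
  have h1' : 0 < 1 - ρ := by linarith
  have A : ∀ n, ∑ j ∈ Finset.range n, (if k ≤ j then ρ ^ dd j k else 0) ≤ (1 - ρ ^ (n - k)) / (1 - ρ) := by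
    intro n
    induction n with
    | zero => simp
    | succ n ih =>
      rw [Finset.sum_range_succ]
      split_ifs with h
      · have e : n + 1 - k = (n - k) + 1 := by omega
        have e2 : dd n k = n - k := by unfold dd; omega
        rw [e, e2, pow_succ]
        refine (add_le_add_left ih _).trans (le_of_eq ?_)
        field_simp; ring
      · have e : n + 1 - k = n - k := by omega
        rw [e, add_zero]; exact ih
  have Bb : ∀ n, ∑ j ∈ Finset.range n, (if k ≤ j then 0 else ρ ^ dd j k) ≤ ρ ^ (k - n) * (ρ / (1 - ρ)) := by
    intro n
    induction n with
    | zero => simp; positivity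
    | succ n ih =>
      rw [Finset.sum_range_succ]
      split_ifs with h
      · have e : k - (n+1) = k - n := by omega
        rw [e, add_zero]; exact ih
      · have e : k - n = (k - (n + 1)) + 1 := by omega
        have e2 : dd n k = k - n := by unfold dd; omega
        rw [e2]
        refine (add_le_add_left ih _).trans (le_of_eq ?_)
        rw [e, pow_succ]
        field_simp; ring
  have e : ∑ j ∈ Finset.range n, ρ ^ dd j k = ∑ j ∈ Finset.range n, (if k ≤ j then ρ ^ dd j k else 0)
      + ∑ j ∈ Finset.range n, (if k ≤ j then 0 else ρ ^ dd j k) := by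
    rw [← Finset.sum_add_distrib]
    refine Finset.sum_congr rfl fun j _ => ?_
    split_ifs <;> simp
  rw [e]
  have a1 : (1 - ρ ^ (n - k)) / (1 - ρ) ≤ 1 / (1 - ρ) := by
    have : 0 < ρ ^ (n-k) := by positivity
    gcongr; linarith
  have a2 : ρ ^ (k - n) * (ρ / (1 - ρ)) ≤ 1 / (1 - ρ) := by
    have : ρ ^ (k-n) ≤ 1 := pow_le_one₀ h0.le h1.le
    calc _ ≤ 1 * (ρ / (1 - ρ)) := by gcongr
      _ ≤ _ := by rw [one_mul]; gcongr
  have := A n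
  have := Bb n
  have : 2 / (1 - ρ) = 1 / (1-ρ) + 1 / (1-ρ) := by ring
  linarith

lemma exp_beats (κ γ : ℝ) (hκ : 0 < κ) (D : ℕ) : ∃ CE : ℝ, 0 < CE ∧ ∀ u : ℝ, 1 ≤ u →
    u ^ γ * Real.exp (-u / κ) ≤ CE * (u⁻¹) ^ D := by
  obtain ⟨N, hN⟩ := exists_nat_ge γ
  refine ⟨(N+D).factorial * κ ^ (N+D), by positivity, fun u hu => ?_⟩
  have hu0 : 0 < u := by linarith
  have h1 := Real.pow_div_factorial_le_exp (u/κ) (by positivity) (N+D)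
  have h2 : u ^ γ ≤ u ^ N := by
    rw [← Real.rpow_natCast]; exact Real.rpow_le_rpow_of_exponent_le hu hN
  rw [neg_div, Real.exp_neg, inv_pow]
  rw [div_le_iff₀ (by positivity), div_pow, div_le_iff₀ (by positivity)] at h1
  calc u ^ γ * (Real.exp (u/κ))⁻¹ ≤ u ^ N * (Real.exp (u/κ))⁻¹ := by gcongr
    _ ≤ _ := by
      rw [← div_eq_mul_inv, ← div_eq_mul_inv, div_le_div_iff₀ (Real.exp_pos _) (by positivity),
        ← pow_add]
      linarith

lemma step2 {Λ st q Q M} (B : BData Λ st q Q M) (κ : ℝ) (hκ : 1 < κ) (hκq : κ ^ 2 ≤ q)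
    (γ : ℝ) (hγ : 0 ≤ γ) :
    ∃ C5 T2 : ℝ, 0 < C5 ∧ 1 < T2 ∧
    ∀ (n : ℕ) (a : ℕ → ℂ) (P : ℕ → ℝ), (∀ j, 0 ≤ P j) →
    (∀ j x, ‖ES (blk st j) Λ a x‖ ≤ P j * Wt (Λ (st j) / κ) (κ * Λ (st (j+1) - 1)) x) →
    (∀ j G, (∀ x, ‖ES (blk st j) Λ a x‖ ≤ G * Wt (Λ (st j) / κ) (κ * Λ (st (j+1) - 1)) x) → P j ≤ G) →
    ∀ k < n, Λ (st k) ^ (-γ) * P k ≤ C5 * (Λ (st k) ^ (-γ) * (Λ (st k) *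
          ∫ x in (1 / Λ (st k))..(T2 / Λ (st k)), ‖ES (Finset.range (st n)) Λ a x‖))
        + 1 / 16 * ∑ j ∈ Finset.range n, (1/2:ℝ) ^ dd j k * (Λ (st j) ^ (-γ) * P j) := by
  obtain ⟨C9, hC9, h9⟩ := step B κ hκ hκq
  obtain ⟨D, hD⟩ := pow_unbounded_of_one_lt (4 * C9) B.hq
  obtain ⟨C8, hC8, h8⟩ := h9 D
  obtain ⟨CE, hCE, hE⟩ := exp_beats κ γ (by linarith) D
  obtain ⟨L, hL⟩ := exists_pow_lt_of_lt_one
    (show (0:ℝ) < 1 / (16 * C8 * (1 + CE)) by positivity) (show (1/2:ℝ) < 1 by norm_num)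
  obtain ⟨C5, T2, hC5, hT2, h5⟩ := h8 L
  refine ⟨C5, T2, hC5, hT2, ?_⟩
  intro n a P hP0 hP hPmin k hk
  obtain ⟨G, hG, hGle⟩ := h5 n a P hP0 hP k hk
  have hPk := (hPmin k G hG).trans hGle
  have hm0 : 0 < Λ (st k) := B.pos _
  have hq0 : 0 < q := by have := B.hq; linarith
  set m := Λ (st k) with hm
  set N := m * ∫ x in (1 / m)..(T2 / m), ‖ES (Finset.range (st n)) Λ a x‖ with hN
  have hmγ : 0 < m ^ (-γ) := Real.rpow_pos_of_pos hm0 _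
  -- decay
  have hdecay : ∀ i, L < i → C8 * C9 ^ L * (1 + CE) * ((q ^ i)⁻¹) ^ D ≤ 1/16 * (1/2:ℝ) ^ i := by
    intro i hi
    have e1 : ((q ^ i)⁻¹) ^ D = ((q ^ D) ^ i)⁻¹ := by rw [inv_pow, ← pow_mul, ← pow_mul, mul_comm]
    have e2 : ((q ^ D) ^ i)⁻¹ ≤ ((4 * C9) ^ i)⁻¹ := by
      have : (0:ℝ) < (4 * C9) ^ i := by positivity
      gcongr
    have e3 : C9 ^ L ≤ C9 ^ i := pow_le_pow_right₀ hC9 hi.le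
    have e4 : (1/2:ℝ) ^ i ≤ (1/2) ^ L := pow_le_pow_of_le_one (by norm_num) (by norm_num) hi.le
    have e5 : C8 * (1 + CE) * (1/2:ℝ) ^ L ≤ 1 / 16 := by
      rw [lt_div_iff₀ (by positivity)] at hL
      rw [le_div_iff₀ (by norm_num)]
      linarith
    have hC90 : 0 < C9 := by linarith
    calc C8 * C9 ^ L * (1 + CE) * ((q ^ i)⁻¹) ^ D ≤ C8 * C9 ^ i * (1 + CE) * ((4 * C9) ^ i)⁻¹ := by
          rw [e1]; gcongr
      _ = C8 * (1 + CE) * (1/2) ^ i * (1/2) ^ i := by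
          have : (4 * C9) ^ i = 2 ^ i * 2 ^ i * C9 ^ i := by
            rw [← mul_pow, ← mul_pow]; norm_num
          rw [this, one_div, inv_pow]; field_simp
      _ ≤ C8 * (1 + CE) * (1/2) ^ L * (1/2) ^ i := by gcongr
      _ ≤ _ := by gcongr
  set b : ℕ → ℝ := fun j => Λ (st j) ^ (-γ) * P j with hb
  have hb0 : ∀ j, 0 ≤ b j := fun j => mul_nonneg (Real.rpow_nonneg (B.pos _).le _) (hP0 j)
  have hPb : ∀ j, m ^ (-γ) * P j = (Λ (st j) / m) ^ γ * b j := by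
    intro j
    have := B.pos (st j)
    simp only [hb]
    rw [Real.div_rpow this.le hm0.le, Real.rpow_neg hm0.le, Real.rpow_neg this.le]
    have := Real.rpow_pos_of_pos this γ
    have := Real.rpow_pos_of_pos hm0 γ
    field_simp
  have hlow : ∀ j, j + L < k → C8 * C9 ^ L * (m ^ (-γ) * ((Λ (st j) / m) ^ D * P j))
      ≤ 1/16 * ((1/2:ℝ) ^ dd j k * b j) := by
    intro j hj
    have hg := B.growth j (k - j)
    rw [show j + (k - j) = k by omega, ← hm] at hg
    have hdd : dd j k = k - j := by unfold dd; omega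
    have hj0 := B.pos (st j)
    have e1 : Λ (st j) / m ≤ (q ^ (k - j))⁻¹ := by
      rw [div_le_iff₀ hm0, inv_mul_eq_div, le_div_iff₀ (by positivity)]; linarith
    have e2 : (Λ (st j) / m) ^ γ ≤ 1 := by
      apply Real.rpow_le_one (by positivity) _ hγ
      refine e1.trans (inv_le_one_of_one_le₀ (one_le_pow₀ B.hq.le))
    have e3 : m ^ (-γ) * ((Λ (st j) / m) ^ D * P j) ≤ ((q ^ (k - j))⁻¹) ^ D * b j := by
      calc _ = (Λ (st j) / m) ^ D * (m ^ (-γ) * P j) := by ring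
        _ = (Λ (st j) / m) ^ D * ((Λ (st j) / m) ^ γ * b j) := by rw [hPb]
        _ ≤ ((q ^ (k - j))⁻¹) ^ D * (1 * b j) := by
          have := hb0 j
          gcongr
        _ = _ := by ring
    have e4 := hdecay (k - j) (by omega)
    have hbj := hb0 j
    have hC90 : 0 < C9 := by linarith
    rw [hdd]
    calc _ ≤ C8 * C9 ^ L * (((q ^ (k - j))⁻¹) ^ D * b j) := by gcongr
      _ ≤ C8 * C9 ^ L * (1 + CE) * ((q ^ (k - j))⁻¹) ^ D * b j := by
        have : 0 ≤ C8 * C9 ^ L * (((q ^ (k - j))⁻¹) ^ D * b j) := by positivity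
        nlinarith
      _ ≤ 1/16 * (1/2:ℝ) ^ (k-j) * b j := by gcongr
      _ = _ := by ring
  have hhigh : ∀ j, k + L < j → C8 * C9 ^ L * (m ^ (-γ) * (Real.exp (- (Λ (st j) / m) / κ) * P j))
      ≤ 1/16 * ((1/2:ℝ) ^ dd j k * b j) := by
    intro j hj
    have hg := B.growth k (j - k)
    rw [show k + (j - k) = j by omega, ← hm] at hg
    have hdd : dd j k = j - k := by unfold dd; omega
    have hj0 := B.pos (st j)
    have e1 : q ^ (j - k) ≤ Λ (st j) / m := by
      rw [le_div_iff₀ hm0]; linarith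
    have e2 := hE (Λ (st j) / m) ((one_le_pow₀ B.hq.le).trans e1)
    have e3 : m ^ (-γ) * (Real.exp (- (Λ (st j) / m) / κ) * P j) ≤
        CE * ((q ^ (j - k))⁻¹) ^ D * b j := by
      calc _ = Real.exp (- (Λ (st j) / m) / κ) * (m ^ (-γ) * P j) := by ring
        _ = ((Λ (st j) / m) ^ γ * Real.exp (- (Λ (st j) / m) / κ)) * b j := by rw [hPb]; ring
        _ ≤ CE * ((Λ (st j) / m)⁻¹) ^ D * b j := by
          have := hb0 j
          gcongr
        _ ≤ _ := by
          have := hb0 j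
          gcongr
    have e4 := hdecay (j - k) (by omega)
    have hbj := hb0 j
    have hC90 : 0 < C9 := by linarith
    rw [hdd]
    calc _ ≤ C8 * C9 ^ L * (CE * ((q ^ (j - k))⁻¹) ^ D * b j) := by gcongr
      _ ≤ C8 * C9 ^ L * (1 + CE) * ((q ^ (j - k))⁻¹) ^ D * b j := by
        have : 0 ≤ C8 * C9 ^ L * (((q ^ (j - k))⁻¹) ^ D * b j) := by positivity
        nlinarith
      _ ≤ 1/16 * (1/2:ℝ) ^ (j-k) * b j := by gcongr
      _ = _ := by ring
  set F := (Finset.range n).filter (fun j => j + L < k) with hF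
  set H := (Finset.range n).filter (fun j => k + L < j) with hH
  have hdisj : Disjoint F H := by
    rw [Finset.disjoint_left]
    intro j h1 h2
    rw [hF, Finset.mem_filter] at h1
    rw [hH, Finset.mem_filter] at h2
    omega
  have hsum : C8 * C9 ^ L * (m ^ (-γ) * (∑ j ∈ F, (Λ (st j) / m) ^ D * P j
            + ∑ j ∈ H, Real.exp (- (Λ (st j) / m) / κ) * P j)) ≤
      1/16 * ∑ j ∈ Finset.range n, (1/2:ℝ) ^ dd j k * b j := by
    have s1 : ∑ j ∈ F, C8 * C9 ^ L * (m ^ (-γ) * ((Λ (st j) / m) ^ D * P j)) ≤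
        ∑ j ∈ F, 1/16 * ((1/2:ℝ) ^ dd j k * b j) :=
      Finset.sum_le_sum fun j hj => hlow j (Finset.mem_filter.1 hj).2
    have s2 : ∑ j ∈ H, C8 * C9 ^ L * (m ^ (-γ) * (Real.exp (- (Λ (st j) / m) / κ) * P j)) ≤
        ∑ j ∈ H, 1/16 * ((1/2:ℝ) ^ dd j k * b j) :=
      Finset.sum_le_sum fun j hj => hhigh j (Finset.mem_filter.1 hj).2
    have s3 : ∑ j ∈ F ∪ H, 1/16 * ((1/2:ℝ) ^ dd j k * b j) ≤
        ∑ j ∈ Finset.range n, 1/16 * ((1/2:ℝ) ^ dd j k * b j) := by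
      apply Finset.sum_le_sum_of_subset_of_nonneg
      · exact Finset.union_subset (Finset.filter_subset _ _) (Finset.filter_subset _ _)
      · intro j _ _; have := hb0 j; positivity
    rw [Finset.sum_union hdisj] at s3
    rw [Finset.mul_sum (Finset.range n)]
    rw [mul_add, mul_add, Finset.mul_sum, Finset.mul_sum, Finset.mul_sum, Finset.mul_sum]
    linarith
  calc m ^ (-γ) * P k ≤ m ^ (-γ) * _ := mul_le_mul_of_nonneg_left hPk hmγ.le
    _ = C5 * (m ^ (-γ) * N) + C8 * C9 ^ L * (m ^ (-γ) * (∑ j ∈ F, (Λ (st j) / m) ^ D * P j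
            + ∑ j ∈ H, Real.exp (- (Λ (st j) / m) / κ) * P j)) := by ring
    _ ≤ _ := add_le_add le_rfl hsum

lemma real_rpow_add_le (x y : ℝ) (hx : 0 ≤ x) (hy : 0 ≤ y) {p : ℝ} (hp : 1 ≤ p) :
    (x + y) ^ p ≤ 2 ^ (p - 1) * (x ^ p + y ^ p) := by
  lift x to NNReal using hx
  lift y to NNReal using hy
  exact_mod_cast NNReal.rpow_add_le_mul_rpow_add_rpow x y hp

/-- discrete absorption -/
lemma lp_absorb (s C5 : ℝ) (hs : 1 ≤ s) (hC5 : 0 < C5) (n : ℕ) (b N : ℕ → ℝ) (hb : ∀ j, 0 ≤ b j)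
    (hN : ∀ j, 0 ≤ N j)
    (h : ∀ k < n, b k ≤ C5 * N k + 1/16 * ∑ j ∈ Finset.range n, (1/2:ℝ) ^ dd j k * b j) :
    ∑ k ∈ Finset.range n, b k ^ s ≤ (2 * C5) ^ s * ∑ k ∈ Finset.range n, N k ^ s := by
  have hs0 : 0 < s := by linarith
  have hw : ∀ k, ∑ j ∈ Finset.range n, (1/2:ℝ) ^ dd j k ≤ 4 := by
    intro k
    have := sum_geo_dd (1/2) (by norm_num) (by norm_num) k n
    norm_num at this ⊢
    exact this
  have jens : ∀ k, (∑ j ∈ Finset.range n, (1/2:ℝ) ^ dd j k * b j) ^ s ≤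
      4 ^ (s - 1) * ∑ j ∈ Finset.range n, (1/2:ℝ) ^ dd j k * b j ^ s := by
    intro k
    have h1 := Real.inner_le_weight_mul_Lp_of_nonneg (Finset.range n) hs (fun j => (1/2:ℝ) ^ dd j k) b
      (fun j => by positivity) hb
    have hS : 0 ≤ ∑ j ∈ Finset.range n, (1/2:ℝ) ^ dd j k * b j ^ s :=
      Finset.sum_nonneg fun j _ => mul_nonneg (by positivity) (Real.rpow_nonneg (hb j) _)
    have hS2 : 0 ≤ ∑ j ∈ Finset.range n, (1/2:ℝ) ^ dd j k :=
      Finset.sum_nonneg fun j _ => by positivity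
    have h2 := Real.rpow_le_rpow (Finset.sum_nonneg fun j _ => mul_nonneg (by positivity) (hb j)) h1 hs0.le
    rw [Real.mul_rpow (Real.rpow_nonneg hS2 _) (Real.rpow_nonneg hS _), ← Real.rpow_mul hS2,
      ← Real.rpow_mul hS, inv_mul_cancel₀ hs0.ne', Real.rpow_one] at h2
    have e : (1 - s⁻¹) * s = s - 1 := by field_simp
    rw [e] at h2
    refine h2.trans ?_
    have := hw k
    have : 0 ≤ s - 1 := by linarith
    gcongr
  have key : ∀ k < n, b k ^ s ≤ 2 ^ (s-1) * C5 ^ s * N k ^ s + 2 ^ (s-1) * ((1/16) ^ s *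
      (4 ^ (s - 1) * ∑ j ∈ Finset.range n, (1/2:ℝ) ^ dd j k * b j ^ s)) := by
    intro k hk
    have hS : 0 ≤ ∑ j ∈ Finset.range n, (1/2:ℝ) ^ dd j k * b j :=
      Finset.sum_nonneg fun j _ => mul_nonneg (by positivity) (hb j)
    have h1 := Real.rpow_le_rpow (hb k) (h k hk) hs0.le
    have h2 := real_rpow_add_le (C5 * N k) (1/16 * ∑ j ∈ Finset.range n, (1/2:ℝ) ^ dd j k * b j) (mul_nonneg hC5.le (hN k)) (by positivity) hs
    refine h1.trans (h2.trans ?_)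
    rw [Real.mul_rpow hC5.le (hN k), Real.mul_rpow (by norm_num) hS, mul_add, mul_assoc]
    have := jens k
    gcongr
  have tot := Finset.sum_le_sum fun k hk => key k (Finset.mem_range.1 hk)
  rw [Finset.sum_add_distrib, ← Finset.mul_sum, ← Finset.mul_sum, ← Finset.mul_sum, ← Finset.mul_sum,
    Finset.sum_comm] at tot
  have hX : ∑ j ∈ Finset.range n, ∑ k ∈ Finset.range n, (1/2:ℝ) ^ dd j k * b j ^ s ≤
      4 * ∑ j ∈ Finset.range n, b j ^ s := by
    rw [Finset.mul_sum]
    refine Finset.sum_le_sum fun j _ => ?_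
    rw [← Finset.sum_mul]
    refine mul_le_mul_of_nonneg_right ?_ (Real.rpow_nonneg (hb j) _)
    have := hw j
    refine le_trans (le_of_eq ?_) this
    refine Finset.sum_congr rfl fun k _ => ?_
    unfold dd; rw [add_comm]
  set X := ∑ j ∈ Finset.range n, b j ^ s
  have hX0 : 0 ≤ X := Finset.sum_nonneg fun j _ => Real.rpow_nonneg (hb j) _
  set Y := ∑ k ∈ Finset.range n, N k ^ s
  have hconst : (2:ℝ) ^ (s-1) * ((1/16) ^ s * (4 ^ (s-1) * (4 * X))) ≤ 1/2 * X := by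
    have e1 : (4:ℝ) ^ (s-1) * 4 = 4 ^ s := by
      rw [← Real.rpow_add_one (by norm_num)]; congr 1; ring
    have e2 : (2:ℝ) ^ (s-1) = 2 ^ s * (1/2) := by
      rw [Real.rpow_sub_one (by norm_num)]; ring
    have e3 : (2:ℝ) ^ s * ((1/16) ^ s * 4 ^ s) = (1/2) ^ s := by
      rw [← Real.mul_rpow (by norm_num) (by norm_num), ← Real.mul_rpow (by norm_num) (by norm_num)]
      norm_num
    have e4 : (1/2:ℝ) ^ s ≤ 1 := Real.rpow_le_one (by norm_num) (by norm_num) hs0.le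
    calc _ = (2 ^ s * ((1/16) ^ s * (4 ^ (s-1) * 4))) * (1/2) * X := by rw [e2]; ring
      _ = (1/2) ^ s * (1/2) * X := by rw [e1, e3]
      _ ≤ 1 * (1/2) * X := by gcongr
      _ = _ := by ring
  have h3 : (2:ℝ) ^ (s-1) * ((1/16) ^ s * (4 ^ (s-1) *
      ∑ j ∈ Finset.range n, ∑ k ∈ Finset.range n, (1/2:ℝ) ^ dd j k * b j ^ s)) ≤ 1/2 * X := by
    refine le_trans ?_ hconst
    gcongr
  have e2 : (2:ℝ) ^ (s-1) = 2 ^ s * (1/2) := by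
    rw [Real.rpow_sub_one (by norm_num)]; ring
  rw [Real.mul_rpow (by norm_num) hC5.le]
  rw [e2] at tot h3
  linarith


lemma jensen_window (s m T : ℝ) (hs : 1 ≤ s) (hm : 0 < m) (hT : 1 < T) (g : ℝ → ℂ)
    (hg : Continuous g) :
    ENNReal.ofReal ((m * ∫ x in (1/m)..(T/m), ‖g x‖) ^ s) ≤
      ENNReal.ofReal (T ^ (s-1) * m) * ∫⁻ x in Ioc (1/m) (T/m), ‖g x‖ₑ ^ s := by
  have hs0 : 0 < s := by linarith
  have h1T : 1/m ≤ T/m := by gcongr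
  set I := ∫ x in (1/m)..(T/m), ‖g x‖ with hI
  have hI0 : 0 ≤ I := intervalIntegral.integral_nonneg h1T fun _ _ => norm_nonneg _
  have e1 : ENNReal.ofReal I = ∫⁻ x in Ioc (1/m) (T/m), ‖g x‖ₑ := by
    rw [hI, intervalIntegral.integral_of_le h1T, ofReal_integral_norm_eq_lintegral_enorm]
    exact hg.integrableOn_Ioc
  set J := ∫⁻ x in Ioc (1/m) (T/m), ‖g x‖ₑ ^ s with hJ
  have hold := ENNReal.lintegral_mul_norm_pow_le (μ := volume.restrict (Ioc (1/m) (T/m)))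
    (f := fun x => ‖g x‖ₑ ^ s) (g := fun _ => 1)
    ((hg.enorm.measurable.pow_const s).aemeasurable) aemeasurable_const
    (p := 1/s) (q := 1 - 1/s) (by positivity) (by rw [sub_nonneg, div_le_one hs0]; exact hs) (by ring)
  have e2 : ∀ x, (‖g x‖ₑ ^ s) ^ (1/s) * (1:ENNReal) ^ (1 - 1/s) = ‖g x‖ₑ := by
    intro x
    rw [ENNReal.one_rpow, mul_one, ← ENNReal.rpow_mul, mul_one_div_cancel hs0.ne', ENNReal.rpow_one]
  simp only [e2] at hold
  rw [← e1, ← hJ, lintegral_one, Measure.restrict_apply_univ, Real.volume_Ioc] at hold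
  have hold2 := ENNReal.rpow_le_rpow hold hs0.le
  rw [ENNReal.mul_rpow_of_nonneg _ _ hs0.le, ← ENNReal.rpow_mul, ← ENNReal.rpow_mul,
    one_div_mul_cancel hs0.ne', ENNReal.rpow_one] at hold2
  have e3 : (1 - 1/s) * s = s - 1 := by field_simp
  rw [e3] at hold2
  have e4 : ENNReal.ofReal (T/m - 1/m) ^ (s-1) ≤ ENNReal.ofReal ((T/m) ^ (s-1)) := by
    rw [← ENNReal.ofReal_rpow_of_nonneg (by positivity) (by linarith)]
    apply ENNReal.rpow_le_rpow _ (by linarith)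
    apply ENNReal.ofReal_le_ofReal
    have : 0 ≤ 1/m := by positivity
    linarith
  rw [Real.mul_rpow hm.le hI0, ENNReal.ofReal_mul (Real.rpow_nonneg hm.le _),
    ← ENNReal.ofReal_rpow_of_nonneg hI0 hs0.le]
  calc ENNReal.ofReal (m ^ s) * ENNReal.ofReal I ^ s
      ≤ ENNReal.ofReal (m ^ s) * (J * ENNReal.ofReal ((T/m) ^ (s-1))) := by
        gcongr
        exact hold2.trans (by gcongr)
    _ = ENNReal.ofReal (m ^ s * (T/m) ^ (s-1)) * J := by
        rw [ENNReal.ofReal_mul (by positivity)]; ring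
    _ = _ := by
        congr 2
        rw [Real.div_rpow (by linarith) hm.le, Real.rpow_sub_one hm.ne' s]
        have : m ^ s ≠ 0 := (Real.rpow_pos_of_pos hm s).ne'
        field_simp

lemma dens_lower (α m0 T : ℝ) (hm0 : 0 < m0) (hT : 1 < T) : ∃ K : ℝ, 0 < K ∧
    ∀ m x, m0 ≤ m → 1/m ≤ x → x ≤ T/m →
      m ^ (1-α) ≤ K * (Real.exp (-x) * (1 - Real.exp (-x)) ^ (α-1)) := by
  set X := T / m0 with hX
  set c1 := Real.exp (-X) with hc1
  have hc10 : 0 < c1 := Real.exp_pos _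
  have hT0 : 0 < T := by linarith
  refine ⟨Real.exp X * (c1 ^ (1-α) + T ^ (1-α)), by positivity, ?_⟩
  intro m x hm h1 h2
  have hm' : 0 < m := by linarith
  have hx0 : 0 < x := lt_of_lt_of_le (by positivity) h1
  have hxX : x ≤ X := h2.trans (by rw [hX]; gcongr)
  set y := 1 - Real.exp (-x) with hy
  have hy1 : c1 / m ≤ y := by
    have := Real.add_one_le_exp x
    have e : Real.exp (-x) * Real.exp x = 1 := by rw [← Real.exp_add]; simp
    have h3 : x * Real.exp (-x) ≤ y := by
      have := Real.exp_pos (-x)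
      rw [hy]; nlinarith
    have h4 : c1 ≤ Real.exp (-x) := Real.exp_le_exp.2 (by linarith)
    calc c1 / m = 1/m * c1 := by ring
      _ ≤ x * Real.exp (-x) := by gcongr
      _ ≤ y := h3
  have hy2 : y ≤ T / m := by
    have := Real.add_one_le_exp (-x)
    rw [hy]; linarith
  have hy0 : 0 < y := lt_of_lt_of_le (by positivity) hy1
  have key : m ^ (1-α) ≤ (c1 ^ (1-α) + T ^ (1-α)) * y ^ (α-1) := by
    have aux : ∀ c, 0 < c → (c / m) ^ (α-1) ≤ y ^ (α-1) → m ^ (1-α) ≤ c ^ (1-α) * y ^ (α-1) := by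
      intro c hc h
      have e : m ^ (1-α) = c ^ (1-α) * (c/m) ^ (α-1) := by
        rw [Real.div_rpow hc.le hm'.le, show (1-α) = -(α-1) by ring, Real.rpow_neg hm'.le,
          Real.rpow_neg hc.le]
        have := Real.rpow_pos_of_pos hc (α-1)
        have := Real.rpow_pos_of_pos hm' (α-1)
        field_simp
      rw [e]; gcongr
    have p1 : 0 ≤ c1 ^ (1-α) * y ^ (α-1) := by positivity
    have p2 : 0 ≤ T ^ (1-α) * y ^ (α-1) := by positivity
    rw [add_mul]
    rcases le_total 1 α with ha | ha
    · have := aux c1 hc10 (Real.rpow_le_rpow (by positivity) hy1 (by linarith))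
      linarith
    · have := aux T hT0 (Real.rpow_le_rpow_of_nonpos hy0 hy2 (by linarith))
      linarith
  have he : 1 ≤ Real.exp X * Real.exp (-x) := by
    rw [← Real.exp_add]; exact Real.one_le_exp (by linarith)
  have p3 : 0 ≤ (c1 ^ (1-α) + T ^ (1-α)) * y ^ (α-1) := by positivity
  calc m ^ (1-α) ≤ 1 * ((c1 ^ (1-α) + T ^ (1-α)) * y ^ (α-1)) := by linarith
    _ ≤ (Real.exp X * Real.exp (-x)) * ((c1 ^ (1-α) + T ^ (1-α)) * y ^ (α-1)) := by gcongr
    _ = _ := by ring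

lemma overlap {Λ st q Q M} (B : BData Λ st q Q M) (T : ℝ) (hT : 1 < T) : ∃ m0 : ℕ, 0 < m0 ∧
    ∀ (n : ℕ) (x : ℝ), ((Finset.range n).filter fun k => x ∈ Ioc (1 / Λ (st k)) (T / Λ (st k))).card ≤ m0 := by
  obtain ⟨m0, hm0⟩ := pow_unbounded_of_one_lt T B.hq
  have hpos : 0 < m0 := by
    rcases Nat.eq_zero_or_pos m0 with h | h
    · rw [h, pow_zero] at hm0; linarith
    · exact h
  refine ⟨m0, hpos, fun n x => ?_⟩
  set S := (Finset.range n).filter fun k => x ∈ Ioc (1 / Λ (st k)) (T / Λ (st k)) with hS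
  rcases S.eq_empty_or_nonempty with h | h
  · rw [h]; simp
  · have hsub : S ⊆ Finset.Ico (S.min' h) (S.min' h + m0) := by
      intro k hk
      rw [Finset.mem_Ico]
      refine ⟨S.min'_le k hk, ?_⟩
      by_contra hc
      push Not at hc
      have hj := S.min'_mem h
      set j := S.min' h
      have hj2 := (Finset.mem_filter.1 hj).2
      have hk2 := (Finset.mem_filter.1 hk).2
      have hg := B.growth j (k - j)
      rw [show j + (k - j) = k by omega] at hg
      have h1 : q ^ m0 ≤ q ^ (k - j) := pow_le_pow_right₀ B.hq.le (by omega)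
      have hj0 := B.pos (st j)
      have hk0 := B.pos (st k)
      have h2 : 1 / Λ (st j) < T / Λ (st k) := hj2.1.trans_le hk2.2
      rw [div_lt_div_iff₀ hj0 hk0] at h2
      nlinarith
    refine (Finset.card_le_card hsub).trans ?_
    simp

lemma change_var (α s : ℝ) (hs : 0 < s) (g f : ℝ → ℂ) (hf : Measurable f)
    (hfg : ∀ x, 0 < x → f (Real.exp (-x)) = g x) :
    ∫⁻ x in Ioi 0, ‖g x‖ₑ ^ s * ENNReal.ofReal (Real.exp (-x) * (1 - Real.exp (-x)) ^ (α-1)) ≤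
      eLpNorm f (ENNReal.ofReal s) (nuMeas α) ^ s := by
  have hs' : ENNReal.ofReal s ≠ 0 := by simpa using hs
  rw [eLpNorm_eq_lintegral_rpow_enorm_toReal hs' ENNReal.ofReal_ne_top, ENNReal.toReal_ofReal hs.le,
    ← ENNReal.rpow_mul, one_div_mul_cancel hs.ne', ENNReal.rpow_one]
  have hmeas : Measurable fun x : ℝ => ENNReal.ofReal ((1 - x) ^ (α - 1)) := by fun_prop
  have hmeas2 : Measurable fun x => ‖f x‖ₑ ^ s := hf.enorm.pow_const s
  rw [nuMeas, lintegral_withDensity_eq_lintegral_mul _ hmeas hmeas2]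
  have hcv := lintegral_image_eq_lintegral_abs_deriv_mul (s := Ioi (0:ℝ))
    (f := fun x => Real.exp (-x)) (f' := fun x => -Real.exp (-x)) measurableSet_Ioi
    (fun x _ => by
      have := (Real.hasDerivAt_exp (-x)).comp x (hasDerivAt_neg x)
      exact (this.congr_deriv (by ring)).hasDerivWithinAt)
    (fun x _ y _ h => by simpa using h)
    (fun t => ENNReal.ofReal ((1 - t) ^ (α - 1)) * ‖f t‖ₑ ^ s)
  have hsub : (fun x => Real.exp (-x)) '' Ioi (0:ℝ) ⊆ Icc 0 1 := by
    rintro _ ⟨x, hx, rfl⟩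
    exact ⟨(Real.exp_pos _).le, Real.exp_le_one_iff.2 (by simpa using (le_of_lt hx))⟩
  calc _ = ∫⁻ x in Ioi 0, ENNReal.ofReal |(-Real.exp (-x))| *
        (ENNReal.ofReal ((1 - Real.exp (-x)) ^ (α - 1)) * ‖f (Real.exp (-x))‖ₑ ^ s) := by
        apply setLIntegral_congr_fun measurableSet_Ioi
        intro x hx
        simp only
        rw [hfg x hx, abs_neg, abs_of_pos (Real.exp_pos _), ENNReal.ofReal_mul (Real.exp_pos _).le]
        ring
    _ = _ := hcv.symm
    _ ≤ ∫⁻ t in Icc 0 1, ENNReal.ofReal ((1 - t) ^ (α - 1)) * ‖f t‖ₑ ^ s :=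
        lintegral_mono_set hsub
    _ = _ := rfl

lemma transfer {Λ st q Q M} (B : BData Λ st q Q M) (α s T : ℝ) (hs : 1 ≤ s)
    (hT : 1 < T) : ∃ K : ℝ, 0 < K ∧ ∀ (n : ℕ) (g f : ℝ → ℂ), Continuous g → Measurable f →
    (∀ x, 0 < x → f (Real.exp (-x)) = g x) →
    ENNReal.ofReal (∑ k ∈ Finset.range n, (Λ (st k) ^ (-(α/s)) * (Λ (st k) *
        ∫ x in (1 / Λ (st k))..(T / Λ (st k)), ‖g x‖)) ^ s) ≤
      ENNReal.ofReal K * eLpNorm f (ENNReal.ofReal s) (nuMeas α) ^ s := by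
  have hs0 : 0 < s := by linarith
  obtain ⟨K, hK, hdens⟩ := dens_lower α (Λ 0) T (B.pos 0) hT
  obtain ⟨m0, hm0, hov⟩ := overlap B T hT
  refine ⟨T ^ (s-1) * K * m0, by positivity, ?_⟩
  intro n g f hg hf hfg
  have hcv := change_var α s hs0 g f hf hfg
  set ρ : ℝ → ENNReal := fun x => ENNReal.ofReal (Real.exp (-x) * (1 - Real.exp (-x)) ^ (α-1)) with hρ
  set E := eLpNorm f (ENNReal.ofReal s) (nuMeas α) ^ s with hE
  have hI0 : ∀ k, 0 ≤ Λ (st k) * ∫ x in (1 / Λ (st k))..(T / Λ (st k)), ‖g x‖ := by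
    intro k
    have := B.pos (st k)
    refine mul_nonneg this.le (intervalIntegral.integral_nonneg (by gcongr) fun _ _ => norm_nonneg _)
  have hone : ∀ k, ENNReal.ofReal ((Λ (st k) ^ (-(α/s)) * (Λ (st k) *
        ∫ x in (1 / Λ (st k))..(T / Λ (st k)), ‖g x‖)) ^ s) ≤
      ENNReal.ofReal (T ^ (s-1) * K) * ∫⁻ x in Ioc (1 / Λ (st k)) (T / Λ (st k)), ‖g x‖ₑ ^ s * ρ x := by
    intro k
    have hm := B.pos (st k)
    have hj := jensen_window s (Λ (st k)) T hs hm hT g hg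
    have hmm : Λ 0 ≤ Λ (st k) := B.mono.monotone (Nat.zero_le _)
    have e0 : -(α/s) * s = -α := by field_simp
    rw [Real.mul_rpow (Real.rpow_nonneg hm.le _) (hI0 k), ← Real.rpow_mul hm.le, e0,
      ENNReal.ofReal_mul (Real.rpow_nonneg hm.le _)]
    calc _ ≤ ENNReal.ofReal (Λ (st k) ^ (-α)) * (ENNReal.ofReal (T ^ (s-1) * Λ (st k)) *
          ∫⁻ x in Ioc (1 / Λ (st k)) (T / Λ (st k)), ‖g x‖ₑ ^ s) := by gcongr
      _ = ENNReal.ofReal (T ^ (s-1)) * ∫⁻ x in Ioc (1 / Λ (st k)) (T / Λ (st k)),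
          ENNReal.ofReal (Λ (st k) ^ (1-α)) * ‖g x‖ₑ ^ s := by
          rw [lintegral_const_mul _ (hg.enorm.measurable.pow_const s), ← mul_assoc, ← mul_assoc,
            ← ENNReal.ofReal_mul (by positivity), ← ENNReal.ofReal_mul (by positivity)]
          congr 2
          rw [show 1 - α = -α + 1 by ring, Real.rpow_add_one hm.ne']; ring
      _ ≤ ENNReal.ofReal (T ^ (s-1)) * ∫⁻ x in Ioc (1 / Λ (st k)) (T / Λ (st k)),
          ENNReal.ofReal K * (‖g x‖ₑ ^ s * ρ x) := by
          gcongr 1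
          apply setLIntegral_mono' measurableSet_Ioc
          intro x hx
          have := ENNReal.ofReal_le_ofReal (hdens (Λ (st k)) x hmm hx.1.le hx.2)
          rw [ENNReal.ofReal_mul hK.le] at this
          calc _ ≤ ENNReal.ofReal K * ρ x * ‖g x‖ₑ ^ s := by gcongr
            _ = _ := by ring
      _ = _ := by
          rw [lintegral_const_mul, ← mul_assoc, ← ENNReal.ofReal_mul (by positivity)]
          exact (hg.enorm.measurable.pow_const s).mul (by fun_prop)
  rw [ENNReal.ofReal_sum_of_nonneg fun k _ => Real.rpow_nonneg (mul_nonneg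
    (Real.rpow_nonneg (B.pos _).le _) (hI0 k)) _]
  have hmeasρ : Measurable fun x => ‖g x‖ₑ ^ s * ρ x :=
    (hg.enorm.measurable.pow_const s).mul (by fun_prop)
  calc _ ≤ ∑ k ∈ Finset.range n, ENNReal.ofReal (T ^ (s-1) * K) *
        ∫⁻ x in Ioc (1 / Λ (st k)) (T / Λ (st k)), ‖g x‖ₑ ^ s * ρ x := Finset.sum_le_sum fun k _ => hone k
    _ = ENNReal.ofReal (T ^ (s-1) * K) * ∑ k ∈ Finset.range n,
        ∫⁻ x, (Ioc (1 / Λ (st k)) (T / Λ (st k))).indicator (fun x => ‖g x‖ₑ ^ s * ρ x) x := by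
        rw [Finset.mul_sum]
        refine Finset.sum_congr rfl fun k _ => ?_
        rw [lintegral_indicator measurableSet_Ioc]
    _ = ENNReal.ofReal (T ^ (s-1) * K) * ∫⁻ x, ∑ k ∈ Finset.range n,
        (Ioc (1 / Λ (st k)) (T / Λ (st k))).indicator (fun x => ‖g x‖ₑ ^ s * ρ x) x := by
        rw [lintegral_finsetSum]
        intro k _
        exact hmeasρ.indicator measurableSet_Ioc
    _ ≤ ENNReal.ofReal (T ^ (s-1) * K) * ∫⁻ x, (Ioi (0:ℝ)).indicator
        (fun x => (m0:ENNReal) * (‖g x‖ₑ ^ s * ρ x)) x := by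
        gcongr with x
        by_cases hx : 0 < x
        · rw [Set.indicator_of_mem (show x ∈ Ioi (0:ℝ) from hx)]
          simp only [Set.indicator_apply]
          rw [← Finset.sum_filter, Finset.sum_const, nsmul_eq_mul]
          gcongr
          exact hov n x
        · refine le_trans (le_of_eq ?_) (zero_le)
          refine Finset.sum_eq_zero fun k _ => ?_
          apply Set.indicator_of_notMem
          intro h
          have := B.pos (st k)
          exact hx (lt_trans (by positivity) h.1)
    _ = ENNReal.ofReal (T ^ (s-1) * K) * (m0 * ∫⁻ x in Ioi 0, ‖g x‖ₑ ^ s * ρ x) := by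
        rw [lintegral_indicator measurableSet_Ioi, lintegral_const_mul _ hmeasρ]
    _ ≤ ENNReal.ofReal (T ^ (s-1) * K) * (m0 * E) := by gcongr
    _ = _ := by
        rw [ENNReal.ofReal_mul (by positivity : 0 ≤ T ^ (s-1) * K), ENNReal.ofReal_natCast, mul_assoc]


lemma coeff_bound {Λ st q Q M} (B : BData Λ st q Q M) (κ : ℝ) (hκ : 1 < κ) (hκq : κ ^ 2 ≤ q)
    (α s : ℝ) (hα : 0 < α) (hs : 1 ≤ s) : ∃ K : ℝ, 0 < K ∧ ∀ f ∈ MuntzPoly Λ, ∃ (n : ℕ) (P : ℕ → ℝ),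
      (∀ j, 0 ≤ P j) ∧ Measurable f ∧
      (∀ t ∈ Icc (0:ℝ) 1, ‖f t‖ ≤ ∑ k ∈ Finset.range n, P k * t ^ (Λ (st k) / κ)) ∧
      ENNReal.ofReal (∑ k ∈ Finset.range n, (Λ (st k) ^ (-(α/s)) * P k) ^ s) ≤
        ENNReal.ofReal K * eLpNorm f (ENNReal.ofReal s) (nuMeas α) ^ s := by
  have hs0 : 0 < s := by linarith
  have hκ0 : 0 < κ := by linarith
  obtain ⟨C5, T2, hC5, hT2, h5⟩ := step2 B κ hκ hκq (α/s) (by positivity)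
  obtain ⟨K, hK, htr⟩ := transfer B α s T2 hs hT2
  refine ⟨(2 * C5) ^ s * K, by positivity, ?_⟩
  rintro f ⟨k0, a0, rfl⟩
  set n := k0 + 1 with hn
  set a : ℕ → ℂ := fun i => if i < n then a0 i else 0 with ha
  have hmeas : Measurable fun t : ℝ => ∑ k ∈ Finset.range n, a0 k * ((t ^ (Λ k) : ℝ) : ℂ) := by
    fun_prop
  have hfg : ∀ x : ℝ, ∑ k ∈ Finset.range n, a0 k * (((Real.exp (-x)) ^ (Λ k) : ℝ) : ℂ)
      = ES (Finset.range (st n)) Λ a x := by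
    intro x
    unfold ES
    have hsub : Finset.range n ⊆ Finset.range (st n) :=
      Finset.range_subset_range.2 (B.st_mono.id_le n)
    rw [← Finset.sum_subset hsub]
    · refine Finset.sum_congr rfl fun i hi => ?_
      rw [Finset.mem_range] at hi
      simp only [ha, if_pos hi]
      rw [← Real.exp_mul]; congr 3; ring
    · intro i _ hi
      rw [Finset.mem_range] at hi
      simp only [ha, if_neg hi, zero_mul]
  have hex : ∀ j, ∃ P : ℝ, 0 ≤ P ∧
      (∀ x, ‖ES (blk st j) Λ a x‖ ≤ P * Wt (Λ (st j) / κ) (κ * Λ (st (j+1) - 1)) x) ∧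
      ∀ G, (∀ x, ‖ES (blk st j) Λ a x‖ ≤ G * Wt (Λ (st j) / κ) (κ * Λ (st (j+1) - 1)) x) → P ≤ G := by
    intro j
    obtain ⟨P0, -, hP0⟩ := ES_bdd (blk st j) Λ a (Λ (st j) / κ) (κ * Λ (st (j+1) - 1)) (fun i hi => by
      have := B.bounds hi
      exact ⟨(div_le_self (B.pos _).le hκ.le).trans this.1,
        this.2.trans (le_mul_of_one_le_left (B.pos _).le hκ.le)⟩)
    exact exists_least _ _ (fun x => Wt_pos _ _ x) P0 hP0
  choose P hP0 hP hPmin using hex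
  refine ⟨n, P, hP0, hmeas, ?_, ?_⟩
  · intro t ht
    rcases ht.1.eq_or_lt with rfl | ht0
    · have : ∑ k ∈ Finset.range n, a0 k * (((0:ℝ) ^ (Λ k) : ℝ) : ℂ) = 0 := by
        refine Finset.sum_eq_zero fun i _ => ?_
        rw [Real.zero_rpow (B.pos i).ne']; simp
      beta_reduce
      rw [this, norm_zero]
      exact Finset.sum_nonneg fun k _ => mul_nonneg (hP0 k) (Real.rpow_nonneg le_rfl _)
    · have hx : t = Real.exp (-(-Real.log t)) := by rw [neg_neg, Real.exp_log ht0]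
      set x := -Real.log t with hxdef
      have hx0 : 0 ≤ x := by
        have := Real.log_nonpos ht.1 ht.2
        linarith
      rw [hx]; beta_reduce; rw [hfg x, ES_blocks Λ st B.st_mono B.st_zero]
      refine (norm_sum_le _ _).trans (Finset.sum_le_sum fun j _ => ?_)
      have := hP j x
      rw [Wt_of_nonneg _ _ _ (div_le_mul_aux hκ (B.pos _) (B.lam_le_top j)) hx0] at this
      rw [← Real.exp_mul]
      refine this.trans (le_of_eq ?_)
      congr 2; ring
  · have hst := lp_absorb s C5 hs hC5 n (fun k => Λ (st k) ^ (-(α/s)) * P k)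
      (fun k => Λ (st k) ^ (-(α/s)) * (Λ (st k) *
          ∫ x in (1 / Λ (st k))..(T2 / Λ (st k)), ‖ES (Finset.range (st n)) Λ a x‖))
      (fun k => mul_nonneg (Real.rpow_nonneg (B.pos _).le _) (hP0 k))
      (fun k => by
        have := B.pos (st k)
        exact mul_nonneg (Real.rpow_nonneg this.le _) (mul_nonneg this.le
          (intervalIntegral.integral_nonneg (by gcongr) fun _ _ => norm_nonneg _)))
      (h5 n a P hP0 hP hPmin)
    refine (ENNReal.ofReal_le_ofReal hst).trans ?_
    rw [ENNReal.ofReal_mul (by positivity), ENNReal.ofReal_mul (by positivity), mul_assoc]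
    gcongr
    exact htr n _ _ (ES_cont _ _ _) hmeas (fun x _ => hfg x)


lemma nu_moment (α a : ℝ) (hα : 0 < α) (ha : 0 < a) :
    ∫⁻ t, ENNReal.ofReal (t ^ a) ∂(nuMeas α) ≤ ENNReal.ofReal ((1/a) ^ α * Real.Gamma α) := by
  have hm1 : Measurable fun x : ℝ => ENNReal.ofReal ((1 - x) ^ (α - 1)) := by fun_prop
  have hm2 : Measurable fun x : ℝ => ENNReal.ofReal (x ^ a) := by fun_prop
  rw [nuMeas, lintegral_withDensity_eq_lintegral_mul _ hm1 hm2]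
  set F : ℝ → ENNReal := (Ici (0:ℝ)).indicator fun y => ENNReal.ofReal (y ^ (α-1) * Real.exp (-(a * y))) with hF
  have hval := Real.integral_rpow_mul_exp_neg_mul_Ioi hα ha
  have hΓ := Real.Gamma_pos_of_pos hα
  have hIntg : Integrable (fun y : ℝ => y ^ (α-1) * Real.exp (-(a * y))) (volume.restrict (Ioi 0)) := by
    by_contra h
    rw [integral_undef h] at hval
    have : 0 < (1/a) ^ α * Real.Gamma α := by positivity
    linarith
  calc _ ≤ ∫⁻ t in Icc (0:ℝ) 1, F (1 - t) := by
        apply setLIntegral_mono' measurableSet_Icc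
        intro t ht
        have h1 : (1 - t) ∈ Ici (0:ℝ) := by simpa using ht.2
        simp only [Pi.mul_apply]
        rw [hF, indicator_of_mem h1, ENNReal.ofReal_mul (Real.rpow_nonneg h1 _)]
        gcongr
        rcases ht.1.eq_or_lt with h0 | h0
        · rw [← h0, Real.zero_rpow ha.ne']; positivity
        · rw [Real.rpow_def_of_pos h0]
          apply Real.exp_le_exp.2
          have := Real.log_le_sub_one_of_pos h0
          nlinarith
    _ ≤ ∫⁻ t, F (1 - t) := setLIntegral_le_lintegral _ _
    _ = ∫⁻ t, F t := lintegral_sub_left_eq_self F 1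
    _ = ∫⁻ y in Ioi 0, ENNReal.ofReal (y ^ (α-1) * Real.exp (-(a * y))) := by
        rw [hF, lintegral_indicator measurableSet_Ici]
        exact setLIntegral_congr Ioi_ae_eq_Ici.symm
    _ = _ := by
        rw [← hval, ofReal_integral_eq_lintegral_ofReal hIntg]
        filter_upwards [ae_restrict_mem measurableSet_Ioi] with y hy
        exact mul_nonneg (Real.rpow_nonneg (le_of_lt hy) _) (Real.exp_pos _).le

lemma mu_moment (Λ : ℕ → ℝ) (n : ℕ → ℕ) (N : ℕ) (α β p : ℝ)
    (hQL : IsQuasiLacunary Λ n N) (hα : 0 < α) (hβ : 1 ≤ β) (hp : β ≤ p)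
    (μ : MeasureTheory.Measure ℝ) (hμ : μ (Set.Icc (0:ℝ) 1)ᶜ = 0)
    (C : ℝ) (hC : 0 < C)
    (hw : ∀ k : ℕ, ∀ f ∈ BlockSpace Λ n k, ∀ lam : ℝ, 0 < lam →
      μ {t : ℝ | t ∈ Set.Icc (0:ℝ) 1 ∧ lam < ‖f t‖} ≤
        ENNReal.ofReal (C ^ p * lam⁻¹ ^ p) *
          MeasureTheory.eLpNorm f (ENNReal.ofReal (p / β)) (nuMeas α) ^ p) (σ : ℝ) (hσ : p < σ) :
    ∃ A : ℝ, 0 < A ∧ ∀ j, ∫⁻ t, ENNReal.ofReal ((t ^ Λ j) ^ σ) ∂μ ≤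
      ENNReal.ofReal (A * Λ j ^ (-(α * β))) := by
  have hp0 : 0 < p := by linarith
  have hβ0 : 0 < β := by linarith
  have hσ0 : 0 < σ := by linarith
  have hΓ := Real.Gamma_pos_of_pos hα
  have haeI : ∀ᵐ t ∂μ, t ∈ Icc (0:ℝ) 1 := hμ
  set K0 : ℝ := C ^ p * ((1 / (p/β)) ^ α * Real.Gamma α) ^ β with hK0
  have hK00 : 0 < K0 := by positivity
  refine ⟨σ * (K0 / (σ - p)), mul_pos hσ0 (div_pos hK00 (by linarith)), fun j => ?_⟩
  have hj0 := hQL.pos j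
  -- the weak estimate
  have hweak : ∀ lam : ℝ, 0 < lam → μ {t : ℝ | lam < t ^ Λ j} ≤
      ENNReal.ofReal (K0 * Λ j ^ (-(α*β)) * lam ^ (-p)) := by
    intro lam hlam
    obtain ⟨k, hk1, hk2⟩ : ∃ k, n k ≤ j ∧ j < n (k+1) := by
      have hex : ∃ k, j < n (k+1) := ⟨j, lt_of_lt_of_le (Nat.lt_succ_self j) (hQL.n_mono.id_le (j+1))⟩
      classical
      refine ⟨Nat.find hex, ?_, Nat.find_spec hex⟩
      rcases Nat.eq_zero_or_pos (Nat.find hex) with h0 | h0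
      · rw [h0, hQL.n_zero]; omega
      · have h1 := Nat.find_min hex (Nat.sub_lt h0 one_pos)
        rw [show Nat.find hex - 1 + 1 = Nat.find hex by omega] at h1
        omega
    set f : ℝ → ℂ := fun t => ((t ^ Λ j : ℝ) : ℂ) with hf
    have hfB : f ∈ BlockSpace Λ n k := by
      refine ⟨fun i => if i = j then 1 else 0, ?_⟩
      funext t
      rw [Finset.sum_eq_single j]
      · simp [hf]
      · intro i _ hi; simp [hi]
      · intro h; exact absurd (Finset.mem_Ico.2 ⟨hk1, hk2⟩) h
    have h1 := hw k f hfB lam hlam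
    have h2 : μ {t : ℝ | lam < t ^ Λ j} ≤ μ {t : ℝ | t ∈ Set.Icc (0:ℝ) 1 ∧ lam < ‖f t‖} := by
      apply measure_mono_ae
      filter_upwards [haeI] with t ht h
      refine ⟨ht, ?_⟩
      have h' : lam < t ^ Λ j := h
      simp only [hf, Complex.norm_real, Real.norm_eq_abs]
      exact h'.trans_le (le_abs_self _)
    have hpb : 0 < p / β := by positivity
    have h3 : eLpNorm f (ENNReal.ofReal (p / β)) (nuMeas α) ^ p ≤
        ENNReal.ofReal (((1 / (Λ j * (p/β))) ^ α * Real.Gamma α) ^ β) := by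
      rw [eLpNorm_eq_lintegral_rpow_enorm_toReal (by simpa using hpb) ENNReal.ofReal_ne_top,
        ENNReal.toReal_ofReal hpb.le, ← ENNReal.rpow_mul,
        show 1 / (p/β) * p = β by field_simp,
        ← ENNReal.ofReal_rpow_of_nonneg (by positivity) hβ0.le]
      apply ENNReal.rpow_le_rpow _ hβ0.le
      refine le_trans (lintegral_mono_ae ?_) (nu_moment α (Λ j * (p/β)) hα (by positivity))
      have hae : ∀ᵐ t ∂(nuMeas α), t ∈ Icc (0:ℝ) 1 := by
        unfold nuMeas
        exact (withDensity_absolutelyContinuous _ _).ae_le (ae_restrict_mem measurableSet_Icc)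
      filter_upwards [hae] with t ht
      simp only [hf]
      rw [← ofReal_norm, Complex.norm_real, Real.norm_eq_abs,
        abs_of_nonneg (Real.rpow_nonneg ht.1 _),
        ENNReal.ofReal_rpow_of_nonneg (Real.rpow_nonneg ht.1 _) hpb.le, Real.rpow_mul ht.1]
    refine h2.trans (h1.trans ?_)
    calc _ ≤ ENNReal.ofReal (C ^ p * lam⁻¹ ^ p) *
          ENNReal.ofReal (((1 / (Λ j * (p/β))) ^ α * Real.Gamma α) ^ β) := by gcongr
      _ = _ := by
        rw [← ENNReal.ofReal_mul (by positivity)]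
        congr 1
        have e1 : (1 / (Λ j * (p/β))) ^ α = Λ j ^ (-α) * (1 / (p/β)) ^ α := by
          rw [Real.rpow_neg hj0.le, ← Real.inv_rpow hj0.le, ← Real.mul_rpow (by positivity) (by positivity)]
          congr 1; field_simp
        rw [e1, mul_assoc (Λ j ^ (-α)), Real.mul_rpow (by positivity) (by positivity), ← Real.rpow_mul hj0.le,
          Real.inv_rpow hlam.le, ← Real.rpow_neg hlam.le, hK0]
        rw [show -α * β = -(α*β) by ring]; ring
  have hzero : ∀ lam : ℝ, 1 ≤ lam → μ {t : ℝ | lam < t ^ Λ j} = 0 := by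
    intro lam hlam
    have : μ {t : ℝ | lam < t ^ Λ j} ≤ μ ∅ := by
      apply measure_mono_ae
      filter_upwards [haeI] with t ht h
      have h' : lam < t ^ Λ j := h
      have := Real.rpow_le_one ht.1 ht.2 hj0.le
      linarith
    simpa using this
  rw [lintegral_rpow_eq_lintegral_meas_lt_mul μ
    (by filter_upwards [haeI] with t ht using Real.rpow_nonneg ht.1 _)
    (by fun_prop) hσ0]
  have hI : ∫⁻ u in Ioi (0:ℝ), μ {t : ℝ | u < t ^ Λ j} * ENNReal.ofReal (u ^ (σ-1)) ≤
      ENNReal.ofReal (K0 / (σ-p) * Λ j ^ (-(α*β))) := by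
    have hIntg : IntervalIntegrable (fun u : ℝ => u ^ (σ - 1 - p)) volume 0 1 :=
      intervalIntegral.intervalIntegrable_rpow' (by linarith)
    have hIntg2 : IntegrableOn (fun u : ℝ => u ^ (σ - 1 - p)) (Ioc 0 1) :=
      (intervalIntegrable_iff_integrableOn_Ioc_of_le zero_le_one).1 hIntg
    have hval : ∫ u in Ioc (0:ℝ) 1, u ^ (σ - 1 - p) = 1 / (σ - p) := by
      rw [← intervalIntegral.integral_of_le zero_le_one, integral_rpow (Or.inl (by linarith))]
      rw [Real.one_rpow, Real.zero_rpow (by linarith), sub_zero]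
      congr 1; ring
    calc _ ≤ ∫⁻ u in Ioi (0:ℝ), (Ioc (0:ℝ) 1).indicator (fun u =>
          ENNReal.ofReal (K0 * Λ j ^ (-(α*β))) * ENNReal.ofReal (u ^ (σ - 1 - p))) u := by
          apply setLIntegral_mono' measurableSet_Ioi
          intro u hu
          have hu : 0 < u := hu
          by_cases h : u ≤ 1
          · rw [indicator_of_mem (show u ∈ Ioc (0:ℝ) 1 from ⟨hu, h⟩)]
            refine (mul_le_mul_left (hweak u hu) _).trans (le_of_eq ?_)
            rw [← ENNReal.ofReal_mul (by positivity), ← ENNReal.ofReal_mul (by positivity)]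
            congr 1
            rw [mul_assoc, ← Real.rpow_add hu]
            congr 2; ring
          · rw [hzero u (by linarith), zero_mul]; exact zero_le
      _ ≤ ∫⁻ u, (Ioc (0:ℝ) 1).indicator (fun u =>
          ENNReal.ofReal (K0 * Λ j ^ (-(α*β))) * ENNReal.ofReal (u ^ (σ - 1 - p))) u :=
          setLIntegral_le_lintegral _ _
      _ = ENNReal.ofReal (K0 * Λ j ^ (-(α*β))) * ENNReal.ofReal (1 / (σ - p)) := by
          rw [lintegral_indicator measurableSet_Ioc, lintegral_const_mul _ (by fun_prop), ← hval,
            ofReal_integral_eq_lintegral_ofReal hIntg2]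
          filter_upwards [ae_restrict_mem measurableSet_Ioc] with u hu
          exact Real.rpow_nonneg hu.1.le _
      _ = _ := by
          rw [← ENNReal.ofReal_mul (by positivity)]
          congr 1; ring
  calc _ ≤ ENNReal.ofReal σ * ENNReal.ofReal (K0 / (σ-p) * Λ j ^ (-(α*β))) := by gcongr
    _ = _ := by rw [← ENNReal.ofReal_mul hσ0.le]; congr 1; ring


lemma pair_bound {κ σ r θ γ ε a b t R : ℝ} (hκ : 0 < κ) (hσ : 0 < σ) (hr : 0 < r) (hγ : 0 < γ)
    (hθ : 0 < θ) (hθ1 : θ ≤ κ * σ) (hθ2 : κ * σ ≤ r - θ)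
    (ha : 0 < a) (hb : 0 < b) (ht : 0 ≤ t) (ht1 : t ≤ 1) (hR : 0 < R) (hR1 : R ≤ 1)
    (h1 : b ≤ a → b / a ≤ R) (h2 : a ≤ b → a / b ≤ R)
    (he0 : 0 < ε) (he1 : ε ≤ γ * θ) (he2 : ε ≤ γ * r * (θ / (κ * σ)) - γ * θ) :
    (a ^ γ * t ^ (a / κ)) ^ (r - θ) * (b ^ γ * t ^ (b / κ)) ^ θ ≤
      R ^ ε * (a ^ (γ * r) * (t ^ a) ^ σ + b ^ (γ * r) * (t ^ b) ^ σ) := by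
  have hκσ : 0 < κ * σ := mul_pos hκ hσ
  have hrθ : 0 < r - θ := lt_of_lt_of_le hκσ hθ2
  have hU1 : 0 ≤ a ^ (γ * r) * (t ^ a) ^ σ := by positivity
  have hU2 : 0 ≤ b ^ (γ * r) * (t ^ b) ^ σ := by positivity
  have e1 : (a ^ γ * t ^ (a / κ)) ^ (r - θ) = a ^ (γ * (r - θ)) * t ^ (a / κ * (r - θ)) := by
    rw [Real.mul_rpow (by positivity) (by positivity), ← Real.rpow_mul ha.le, ← Real.rpow_mul ht]
  have e2 : (b ^ γ * t ^ (b / κ)) ^ θ = b ^ (γ * θ) * t ^ (b / κ * θ) := by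
    rw [Real.mul_rpow (by positivity) (by positivity), ← Real.rpow_mul hb.le, ← Real.rpow_mul ht]
  have e3 : t ^ (a / κ * (r - θ)) ≤ (t ^ a) ^ σ := by
    rw [← Real.rpow_mul ht]
    apply Real.rpow_le_rpow_of_exponent_ge' ht ht1 (by positivity)
    have : a * σ = a / κ * (κ * σ) := by field_simp
    rw [this]; gcongr
  rw [e1, e2]
  rcases le_total b a with hab | hab
  · have hRb : (b / a) ^ (γ * θ) ≤ R ^ ε :=
      (Real.rpow_le_rpow (by positivity) (h1 hab) (by positivity)).trans
        (Real.rpow_le_rpow_of_exponent_ge hR hR1 he1)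
    have e4 : t ^ (b / κ * θ) ≤ 1 := Real.rpow_le_one ht ht1 (by positivity)
    have e5 : a ^ (γ * (r - θ)) * b ^ (γ * θ) = (b / a) ^ (γ * θ) * a ^ (γ * r) := by
      rw [Real.div_rpow hb.le ha.le, mul_sub, Real.rpow_sub ha]
      field_simp
    calc a ^ (γ * (r - θ)) * t ^ (a / κ * (r - θ)) * (b ^ (γ * θ) * t ^ (b / κ * θ))
        ≤ a ^ (γ * (r - θ)) * (t ^ a) ^ σ * (b ^ (γ * θ) * 1) := by gcongr
      _ = (a ^ (γ * (r - θ)) * b ^ (γ * θ)) * (t ^ a) ^ σ := by ring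
      _ = (b / a) ^ (γ * θ) * (a ^ (γ * r) * (t ^ a) ^ σ) := by rw [e5]; ring
      _ ≤ R ^ ε * (a ^ (γ * r) * (t ^ a) ^ σ + b ^ (γ * r) * (t ^ b) ^ σ) := by
          gcongr; linarith
  · set v := θ / (κ * σ) with hv
    have hv0 : 0 < v := by positivity
    have hv1 : v ≤ 1 := by rw [hv, div_le_one hκσ]; exact hθ1
    have hRb : (a / b) ^ (γ * r * v - γ * θ) ≤ R ^ ε :=
      (Real.rpow_le_rpow (by positivity) (h2 hab) (by linarith)).trans
        (Real.rpow_le_rpow_of_exponent_ge hR hR1 he2)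
    have e3' : t ^ (a / κ * (r - θ)) ≤ ((t ^ a) ^ σ) ^ (1 - v) := by
      refine e3.trans ?_
      have h0 : 0 ≤ (t ^ a) ^ σ := by positivity
      have h1 : (t ^ a) ^ σ ≤ 1 := by
        rw [← Real.rpow_mul ht]; exact Real.rpow_le_one ht ht1 (by positivity)
      calc (t ^ a) ^ σ = ((t ^ a) ^ σ) ^ (1:ℝ) := (Real.rpow_one _).symm
        _ ≤ _ := Real.rpow_le_rpow_of_exponent_ge' h0 h1 (by linarith) (by linarith)
    have e4 : t ^ (b / κ * θ) = ((t ^ b) ^ σ) ^ v := by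
      rw [← Real.rpow_mul ht, ← Real.rpow_mul ht]
      congr 1
      rw [hv]; field_simp
    have e5 : a ^ (γ * (r - θ)) * b ^ (γ * θ) =
        (a / b) ^ (γ * r * v - γ * θ) * ((a ^ (γ * r)) ^ (1 - v) * (b ^ (γ * r)) ^ v) := by
      rw [Real.div_rpow ha.le hb.le, ← Real.rpow_mul ha.le, ← Real.rpow_mul hb.le]
      have : a ^ (γ * (r - θ)) = a ^ (γ * r * v - γ * θ) * a ^ (γ * r * (1 - v)) := by
        rw [← Real.rpow_add ha]; congr 1; ring
      rw [this]
      have : b ^ (γ * r * v) = b ^ (γ * r * v - γ * θ) * b ^ (γ * θ) := by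
        rw [← Real.rpow_add hb]; congr 1; ring
      rw [this]
      field_simp
    have hY : (a ^ (γ * r) * (t ^ a) ^ σ) ^ (1 - v) * (b ^ (γ * r) * (t ^ b) ^ σ) ^ v ≤
        a ^ (γ * r) * (t ^ a) ^ σ + b ^ (γ * r) * (t ^ b) ^ σ := by
      have := Real.geom_mean_le_arith_mean2_weighted (by linarith : 0 ≤ 1 - v) hv0.le hU1 hU2
        (by ring)
      refine this.trans ?_
      nlinarith
    calc a ^ (γ * (r - θ)) * t ^ (a / κ * (r - θ)) * (b ^ (γ * θ) * t ^ (b / κ * θ))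
        ≤ a ^ (γ * (r - θ)) * ((t ^ a) ^ σ) ^ (1 - v) * (b ^ (γ * θ) * ((t ^ b) ^ σ) ^ v) := by
          rw [e4]; gcongr
      _ = (a ^ (γ * (r - θ)) * b ^ (γ * θ)) * (((t ^ a) ^ σ) ^ (1 - v) * ((t ^ b) ^ σ) ^ v) := by
          ring
      _ = (a / b) ^ (γ * r * v - γ * θ) *
          ((a ^ (γ * r) * (t ^ a) ^ σ) ^ (1 - v) * (b ^ (γ * r) * (t ^ b) ^ σ) ^ v) := by
          rw [e5, Real.mul_rpow (x := a ^ (γ * r)) (by positivity) (by positivity),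
            Real.mul_rpow (x := b ^ (γ * r)) (by positivity) (by positivity)]
          ring
      _ ≤ R ^ ε * (a ^ (γ * r) * (t ^ a) ^ σ + b ^ (γ * r) * (t ^ b) ^ σ) := by
          gcongr

lemma sum_pow_le_pairs (x : ℕ → ℝ) (hx : ∀ k, 0 ≤ x k) (n : ℕ) {ρ r θ : ℝ} (hρ : 0 < ρ)
    (hρ1 : ρ < 1) (hθ : 0 < θ) (hθr : θ < r) :
    (∑ k ∈ Finset.range n, x k) ^ r ≤ (2 / (1 - ρ)) ^ r *
      ∑ k ∈ Finset.range n, ∑ j ∈ Finset.range n,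
        (ρ⁻¹ ^ r) ^ dd j k * (x k ^ (r - θ) * x j ^ θ) := by
  have hr : 0 < r := hθ.trans hθr
  rcases Nat.eq_zero_or_pos n with rfl | hn
  · simp [Real.zero_rpow hr.ne']
  have hne : (Finset.range n).Nonempty := ⟨0, Finset.mem_range.2 hn⟩
  obtain ⟨k, hk, hkm⟩ := Finset.exists_max_image (Finset.range n) x hne
  obtain ⟨j, hj, hjm⟩ := Finset.exists_max_image (Finset.range n)
    (fun j => ρ⁻¹ ^ dd j k * x j) hne
  have h1ρ : 0 < 1 - ρ := by linarith
  have hsum : ∑ i ∈ Finset.range n, x i ≤ 2 / (1 - ρ) * (ρ⁻¹ ^ dd j k * x j) := by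
    calc ∑ i ∈ Finset.range n, x i
        = ∑ i ∈ Finset.range n, ρ ^ dd i k * (ρ⁻¹ ^ dd i k * x i) := by
          refine Finset.sum_congr rfl fun i _ => ?_
          rw [← mul_assoc, ← mul_pow, mul_inv_cancel₀ hρ.ne', one_pow, one_mul]
      _ ≤ ∑ i ∈ Finset.range n, ρ ^ dd i k * (ρ⁻¹ ^ dd j k * x j) := by
          refine Finset.sum_le_sum fun i hi => ?_
          exact mul_le_mul_of_nonneg_left (hjm i hi) (by positivity)
      _ = (∑ i ∈ Finset.range n, ρ ^ dd i k) * (ρ⁻¹ ^ dd j k * x j) := by rw [Finset.sum_mul]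
      _ ≤ _ := by
          refine mul_le_mul_of_nonneg_right (sum_geo_dd ρ hρ hρ1 k n) ?_
          have := hx j
          positivity
  have hxj := hx j
  have hxk := hx k
  have hterm : ∀ k j, 0 ≤ (ρ⁻¹ ^ r) ^ dd j k * (x k ^ (r - θ) * x j ^ θ) := by
    intro k j
    have := hx j
    have := hx k
    positivity
  calc (∑ k ∈ Finset.range n, x k) ^ r
      ≤ (2 / (1 - ρ) * (ρ⁻¹ ^ dd j k * x j)) ^ r :=
        Real.rpow_le_rpow (Finset.sum_nonneg fun i _ => hx i) hsum hr.le
    _ = (2 / (1 - ρ)) ^ r * ((ρ⁻¹ ^ r) ^ dd j k * x j ^ r) := by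
        rw [Real.mul_rpow (by positivity) (by positivity),
          Real.mul_rpow (x := ρ⁻¹ ^ dd j k) (by positivity) (by positivity)]
        congr 2
        rw [← Real.rpow_natCast, ← Real.rpow_natCast, ← Real.rpow_mul (by positivity),
          ← Real.rpow_mul (by positivity), mul_comm]
    _ ≤ (2 / (1 - ρ)) ^ r * ((ρ⁻¹ ^ r) ^ dd j k * (x k ^ (r - θ) * x j ^ θ)) := by
        have : x j ^ r = x j ^ (r - θ) * x j ^ θ := by
          rw [← Real.rpow_add_of_nonneg hxj (by linarith) hθ.le]; congr 1; ring
        rw [this]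
        have := hkm j hj
        have : 0 ≤ r - θ := by linarith
        gcongr
    _ ≤ _ := by
        refine mul_le_mul_of_nonneg_left ?_ (by positivity)
        refine (Finset.single_le_sum (f := fun j => (ρ⁻¹ ^ r) ^ dd j k * (x k ^ (r - θ) * x j ^ θ))
          (fun j _ => hterm k j) hj).trans ?_
        exact Finset.single_le_sum (f := fun k => ∑ j ∈ Finset.range n,
          (ρ⁻¹ ^ r) ^ dd j k * (x k ^ (r - θ) * x j ^ θ))
          (fun k _ => Finset.sum_nonneg fun j _ => hterm k j) hk

lemma mul_pow_le_add {u v r θ : ℝ} (hu : 0 ≤ u) (hv : 0 ≤ v) (hθ : 0 < θ) (hθr : θ < r) :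
    u ^ (r - θ) * v ^ θ ≤ u ^ r + v ^ r := by
  have h : ∀ w : ℝ, 0 ≤ w → w ^ (r - θ) * w ^ θ = w ^ r := fun w hw => by
    rw [← Real.rpow_add_of_nonneg hw (by linarith) hθ.le]; congr 1; ring
  have h3 : 0 ≤ r - θ := by linarith
  rcases le_total u v with huv | huv
  · calc u ^ (r - θ) * v ^ θ ≤ v ^ (r - θ) * v ^ θ := by gcongr
      _ = v ^ r := h v hv
      _ ≤ _ := by have := Real.rpow_nonneg hu r; linarith
  · calc u ^ (r - θ) * v ^ θ ≤ u ^ (r - θ) * u ^ θ := by gcongr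
      _ = u ^ r := h u hu
      _ ≤ _ := by have := Real.rpow_nonneg hv r; linarith

/-- The pointwise bound. -/
lemma pointwise_bound {Λ st q Q M} (B : BData Λ st q Q M) {κ σ r γ : ℝ} (hκ : 0 < κ)
    (hσ : 0 < σ) (hγ : 0 < γ) (hr : κ * σ < r) :
    ∃ D η : ℝ, 0 < D ∧ 0 < η ∧ η < 1 ∧ ∀ (n : ℕ) (b : ℕ → ℝ), (∀ k, 0 ≤ b k) →
      ∀ t ∈ Icc (0:ℝ) 1,
      (∑ k ∈ Finset.range n, b k * (Λ (st k) ^ γ * t ^ (Λ (st k) / κ))) ^ r ≤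
        D * ∑ k ∈ Finset.range n, ∑ j ∈ Finset.range n, η ^ dd j k * ((b k ^ r + b j ^ r) *
          (Λ (st k) ^ (γ * r) * (t ^ Λ (st k)) ^ σ + Λ (st j) ^ (γ * r) * (t ^ Λ (st j)) ^ σ)) := by
  have hκσ : 0 < κ * σ := mul_pos hκ hσ
  have hr0 : 0 < r := hκσ.trans hr
  set θ := min (r - κ * σ) (κ * σ) with hθd
  have hθ : 0 < θ := lt_min (by linarith) hκσ
  have hθ1 : θ ≤ κ * σ := min_le_right _ _
  have hθ2 : κ * σ ≤ r - θ := by have := min_le_left (r - κ * σ) (κ * σ); linarith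
  have hθr : θ < r := by linarith
  set ε := min (γ * θ) (γ * r * (θ / (κ * σ)) - γ * θ) with hεd
  have hε : 0 < ε := by
    refine lt_min (by positivity) ?_
    have : γ * r * (θ / (κ * σ)) - γ * θ = γ * θ * (r - κ * σ) / (κ * σ) := by field_simp
    rw [this]
    have : 0 < r - κ * σ := by linarith
    positivity
  have hq := B.hq
  have hq0 : 0 < q := by linarith
  set ω := (q⁻¹) ^ ε with hω
  have hω0 : 0 < ω := by positivity
  have hω1 : ω < 1 := Real.rpow_lt_one (by positivity) (inv_lt_one_of_one_lt₀ hq) hε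
  set ρ := ω ^ (1 / (2 * r)) with hρ
  have hρ0 : 0 < ρ := by positivity
  have hρ1 : ρ < 1 := Real.rpow_lt_one hω0.le hω1 (by positivity)
  set η := ω ^ (1 / 2 : ℝ) with hη
  have hη0 : 0 < η := by positivity
  have hη1 : η < 1 := Real.rpow_lt_one hω0.le hω1 (by positivity)
  have hprod : ρ⁻¹ ^ r * ω = η := by
    rw [Real.inv_rpow hρ0.le, hρ, ← Real.rpow_mul hω0.le, ← Real.rpow_neg hω0.le]
    nth_rewrite 2 [← Real.rpow_one ω]
    rw [← Real.rpow_add hω0, hη]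
    congr 1
    field_simp
    norm_num
  have h1ρ : 0 < 1 - ρ := by linarith
  refine ⟨(2 / (1 - ρ)) ^ r, η, by positivity, hη0, hη1, ?_⟩
  intro n b hb t ht
  have hp : ∀ k, 0 < Λ (st k) := fun k => B.pos _
  have ht0 := ht.1
  refine (sum_pow_le_pairs (fun k => b k * (Λ (st k) ^ γ * t ^ (Λ (st k) / κ))) ?_ n hρ0 hρ1 hθ
    hθr).trans ?_
  · intro k
    have := hb k
    have := hp k
    positivity
  refine mul_le_mul_of_nonneg_left ?_ (by positivity)
  refine Finset.sum_le_sum fun k _ => Finset.sum_le_sum fun j _ => ?_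
  have hbk := hb k
  have hbj := hb j
  have hpk := hp k
  have hpj := hp j
  have hkj : ∀ k j, k ≤ j → Λ (st k) / Λ (st j) ≤ q⁻¹ ^ (j - k) := by
    intro k j hkj
    have hg := B.growth k (j - k)
    rw [Nat.add_sub_cancel' hkj] at hg
    rw [div_le_iff₀ (hp j), inv_pow, ← div_eq_inv_mul, le_div_iff₀ (by positivity)]
    linarith
  have hlt : ∀ k j, Λ (st k) ≤ Λ (st j) → k ≤ j := by
    intro k j h
    by_contra hc
    have := B.mono (B.st_mono (not_le.1 hc))
    linarith
  have hpb := pair_bound (κ := κ) (σ := σ) (r := r) (θ := θ) (γ := γ) (ε := ε) (a := Λ (st k))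
    (b := Λ (st j)) (t := t) (R := q⁻¹ ^ dd j k) hκ hσ hr0 hγ hθ hθ1 hθ2 hpk hpj ht.1 ht.2
    (by positivity) (pow_le_one₀ (by positivity) (inv_le_one_of_one_le₀ hq.le))
    (fun h => by
      have h1 := hlt j k h
      have h2 : dd j k = k - j := by unfold dd; omega
      rw [h2]; exact hkj j k h1)
    (fun h => by
      have h1 := hlt k j h
      have h2 : dd j k = j - k := by unfold dd; omega
      rw [h2]; exact hkj k j h1)
    hε (min_le_left _ _) (min_le_right _ _)
  have hR : (q⁻¹ ^ dd j k) ^ ε = ω ^ dd j k := by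
    rw [hω, ← Real.rpow_natCast, ← Real.rpow_natCast, ← Real.rpow_mul (by positivity),
      ← Real.rpow_mul (by positivity), mul_comm]
  rw [hR] at hpb
  have hbb := mul_pow_le_add hbk hbj hθ hθr
  rw [Real.mul_rpow hbk (by positivity), Real.mul_rpow hbj (by positivity)]
  calc (ρ⁻¹ ^ r) ^ dd j k * (b k ^ (r - θ) * (Λ (st k) ^ γ * t ^ (Λ (st k) / κ)) ^ (r - θ) *
        (b j ^ θ * (Λ (st j) ^ γ * t ^ (Λ (st j) / κ)) ^ θ))
      = (ρ⁻¹ ^ r) ^ dd j k * ((b k ^ (r - θ) * b j ^ θ) *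
        ((Λ (st k) ^ γ * t ^ (Λ (st k) / κ)) ^ (r - θ) *
          (Λ (st j) ^ γ * t ^ (Λ (st j) / κ)) ^ θ)) := by ring
    _ ≤ (ρ⁻¹ ^ r) ^ dd j k * ((b k ^ r + b j ^ r) * (ω ^ dd j k *
        (Λ (st k) ^ (γ * r) * (t ^ Λ (st k)) ^ σ + Λ (st j) ^ (γ * r) * (t ^ Λ (st j)) ^ σ))) := by
        gcongr
    _ = _ := by
        rw [← hprod, mul_pow]; ring


/-- `F` is measurable and its positive part has integral at most `c`. -/
def LIB (μ : Measure ℝ) (F : ℝ → ℝ) (c : ℝ) : Prop :=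
  Measurable F ∧ 0 ≤ c ∧ ∫⁻ t, ENNReal.ofReal (F t) ∂μ ≤ ENNReal.ofReal c

lemma LIB.add {μ : Measure ℝ} {F G : ℝ → ℝ} {c d : ℝ} (hF : LIB μ F c) (hG : LIB μ G d) :
    LIB μ (fun t => F t + G t) (c + d) := by
  refine ⟨hF.1.add hG.1, add_nonneg hF.2.1 hG.2.1, ?_⟩
  rw [ENNReal.ofReal_add hF.2.1 hG.2.1]
  calc _ ≤ ∫⁻ t, ENNReal.ofReal (F t) + ENNReal.ofReal (G t) ∂μ :=
        lintegral_mono fun t => ENNReal.ofReal_add_le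
    _ = _ := lintegral_add_left hF.1.ennreal_ofReal _
    _ ≤ _ := add_le_add hF.2.2 hG.2.2

lemma LIB.const_mul {μ : Measure ℝ} {F : ℝ → ℝ} {c a : ℝ} (hF : LIB μ F c) (ha : 0 ≤ a) :
    LIB μ (fun t => a * F t) (a * c) := by
  refine ⟨hF.1.const_mul a, mul_nonneg ha hF.2.1, ?_⟩
  simp_rw [ENNReal.ofReal_mul ha]
  rw [lintegral_const_mul _ hF.1.ennreal_ofReal]
  exact mul_le_mul_right hF.2.2 _

lemma LIB.sum {μ : Measure ℝ} {F : ℕ → ℝ → ℝ} {c : ℕ → ℝ} (s : Finset ℕ)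
    (hF : ∀ k, LIB μ (F k) (c k)) :
    LIB μ (fun t => ∑ k ∈ s, F k t) (∑ k ∈ s, c k) := by
  classical
  induction s using Finset.induction_on with
  | empty => simp [LIB]
  | insert a s ha ih =>
    simp_rw [Finset.sum_insert ha]
    exact (hF a).add ih

lemma double_sum_bound {η : ℝ} (h0 : 0 < η) (h1 : η < 1) (n : ℕ) (x : ℕ → ℝ) (hx : ∀ k, 0 ≤ x k) :
    ∑ k ∈ Finset.range n, ∑ j ∈ Finset.range n, η ^ dd j k * (x k + x j) ≤
      2 * (2 / (1 - η)) * ∑ k ∈ Finset.range n, x k := by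
  have hA : ∑ k ∈ Finset.range n, ∑ j ∈ Finset.range n, η ^ dd j k * x k ≤
      2 / (1 - η) * ∑ k ∈ Finset.range n, x k := by
    rw [Finset.mul_sum]
    refine Finset.sum_le_sum fun k _ => ?_
    rw [← Finset.sum_mul]
    exact mul_le_mul_of_nonneg_right (sum_geo_dd η h0 h1 k n) (hx k)
  have hs : ∑ k ∈ Finset.range n, ∑ j ∈ Finset.range n, η ^ dd j k * x j =
      ∑ k ∈ Finset.range n, ∑ j ∈ Finset.range n, η ^ dd j k * x k := by
    rw [Finset.sum_comm]
    refine Finset.sum_congr rfl fun k _ => Finset.sum_congr rfl fun j _ => ?_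
    have : dd k j = dd j k := by unfold dd; omega
    rw [this]
  simp_rw [mul_add, Finset.sum_add_distrib]
  rw [hs]; linarith

lemma sum_rpow_le {n : ℕ} (b : ℕ → ℝ) (hb : ∀ k, 0 ≤ b k) {s r : ℝ} (hs : 0 < s) (hsr : s ≤ r) :
    ∑ k ∈ Finset.range n, b k ^ r ≤ (∑ k ∈ Finset.range n, b k ^ s) ^ (r / s) := by
  set S := ∑ k ∈ Finset.range n, b k ^ s with hS
  have hS0 : 0 ≤ S := Finset.sum_nonneg fun k _ => Real.rpow_nonneg (hb k) _
  have hrs : 0 ≤ r / s - 1 := by rw [sub_nonneg, le_div_iff₀ hs]; linarith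
  calc ∑ k ∈ Finset.range n, b k ^ r
      ≤ ∑ k ∈ Finset.range n, b k ^ s * S ^ (r / s - 1) := by
        refine Finset.sum_le_sum fun k hk => ?_
        have h1 : b k ^ s ≤ S := Finset.single_le_sum (f := fun k => b k ^ s)
          (fun k _ => Real.rpow_nonneg (hb k) _) hk
        have h0 : 0 ≤ b k ^ s := Real.rpow_nonneg (hb k) _
        have : b k ^ r = b k ^ s * (b k ^ s) ^ (r / s - 1) := by
          rw [← Real.rpow_mul (hb k), ← Real.rpow_add_of_nonneg (hb k) hs.le (by positivity)]
          congr 1; field_simp; ring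
        rw [this]
        gcongr
    _ = S * S ^ (r / s - 1) := by rw [← Finset.sum_mul]
    _ = S ^ (r / s) := by
        nth_rewrite 1 [← Real.rpow_one S]
        rw [← Real.rpow_add_of_nonneg hS0 zero_le_one hrs]; congr 1; ring

lemma main_aux
    (Λ : ℕ → ℝ) (n : ℕ → ℕ) (N : ℕ) (α β p : ℝ)
    (hQL : IsQuasiLacunary Λ n N) (hα : 0 < α) (hβ : 1 ≤ β) (hp : β ≤ p)
    (μ : MeasureTheory.Measure ℝ) (hμ : μ (Set.Icc (0:ℝ) 1)ᶜ = 0)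
    (C : ℝ) (hC : 0 < C)
    (hw : ∀ k : ℕ, ∀ f ∈ BlockSpace Λ n k, ∀ lam : ℝ, 0 < lam →
      μ {t : ℝ | t ∈ Set.Icc (0:ℝ) 1 ∧ lam < ‖f t‖} ≤
        ENNReal.ofReal (C ^ p * lam⁻¹ ^ p) *
          MeasureTheory.eLpNorm f (ENNReal.ofReal (p / β)) (nuMeas α) ^ p) :
    ∀ r : ℝ, p < r →
      ∃ Cr : ℝ, 0 < Cr ∧ ∀ f ∈ MuntzPoly Λ,
        MeasureTheory.eLpNorm f (ENNReal.ofReal r) μ ≤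
          ENNReal.ofReal Cr *
            MeasureTheory.eLpNorm f (ENNReal.ofReal (r / β)) (nuMeas α) := by
  intro r hpr
  have hβ0 : 0 < β := by linarith
  have hp0 : 0 < p := by linarith
  have hr0 : 0 < r := by linarith
  set s := r / β with hs
  have hs1 : 1 ≤ s := by rw [hs, le_div_iff₀ hβ0]; linarith
  have hs0 : 0 < s := by linarith
  have hsr : s ≤ r := div_le_self hr0.le hβ
  set σ := (p + r) / 2 with hσd
  have hσp : p < σ := by rw [hσd]; linarith
  have hσr : σ < r := by rw [hσd]; linarith
  have hσ0 : 0 < σ := by linarith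
  obtain ⟨q, Q, M, st, hq, hQ, h3, h4, h5, h6, h7⟩ := reblock Λ n N hQL
  have B : BData Λ st q Q M := ⟨hQL.pos, hQL.mono, hq, hQ, h3, h4, h5, h6, h7⟩
  obtain ⟨κ, hκ1, hκ2⟩ : ∃ κ, 1 < κ ∧ κ < min (Real.sqrt q) (r / σ) := by
    apply exists_between
    refine lt_min ?_ ?_
    · rw [Real.lt_sqrt zero_le_one]; linarith
    · rw [lt_div_iff₀ hσ0]; linarith
  have hκ0 : 0 < κ := by linarith
  have hκq : κ ^ 2 ≤ q := by
    have := (lt_min_iff.1 hκ2).1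
    rw [Real.lt_sqrt hκ0.le] at this
    exact this.le
  have hκr : κ * σ < r := by
    have := (lt_min_iff.1 hκ2).2
    rwa [lt_div_iff₀ hσ0] at this
  obtain ⟨K, hK, hcoef⟩ := coeff_bound B κ hκ1 hκq α s hα hs1
  obtain ⟨A, hA, hmom⟩ := mu_moment Λ n N α β p hQL hα hβ hp μ hμ C hC hw σ hσp
  set γ := α / s with hγd
  have hγ : 0 < γ := by positivity
  have hγr : γ * r = α * β := by rw [hγd, hs]; field_simp
  obtain ⟨D, η, hD, hη0, hη1, hpt⟩ := pointwise_bound B (γ := γ) hκ0 hσ0 hγ hκr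
  have h1η : 0 < 1 - η := by linarith
  set E := D * (2 * A) * (2 * (2 / (1 - η))) with hE
  have hE0 : 0 < E := by positivity
  have hU : ∀ k, LIB μ (fun t => Λ (st k) ^ (γ * r) * (t ^ Λ (st k)) ^ σ) A := by
    intro k
    have hpk := B.pos (st k)
    have h : LIB μ (fun t => (t ^ Λ (st k)) ^ σ) (A * Λ (st k) ^ (-(α * β))) :=
      ⟨by fun_prop, by positivity, hmom (st k)⟩
    have h' := h.const_mul (a := Λ (st k) ^ (γ * r)) (by positivity)
    have e : Λ (st k) ^ (γ * r) * (A * Λ (st k) ^ (-(α * β))) = A := by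
      rw [hγr, Real.rpow_neg hpk.le]
      have : 0 < Λ (st k) ^ (α * β) := by positivity
      field_simp
    rwa [e] at h'
  refine ⟨(E * K ^ (r / s)) ^ (1 / r), by positivity, ?_⟩
  intro f hf
  obtain ⟨m, P, hP, hfm, hfb, hco⟩ := hcoef f hf
  set b : ℕ → ℝ := fun k => Λ (st k) ^ (-γ) * P k with hb
  have hb0 : ∀ k, 0 ≤ b k := fun k => mul_nonneg (Real.rpow_nonneg (B.pos _).le _) (hP k)
  have hPb : ∀ k t, P k * t ^ (Λ (st k) / κ) = b k * (Λ (st k) ^ γ * t ^ (Λ (st k) / κ)) := by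
    intro k t
    have hpk := B.pos (st k)
    have : 0 < Λ (st k) ^ γ := by positivity
    simp only [hb]
    rw [Real.rpow_neg hpk.le]
    field_simp
  have hLI : LIB μ (fun t => D * ∑ k ∈ Finset.range m, ∑ j ∈ Finset.range m,
      η ^ dd j k * ((b k ^ r + b j ^ r) *
          (Λ (st k) ^ (γ * r) * (t ^ Λ (st k)) ^ σ + Λ (st j) ^ (γ * r) * (t ^ Λ (st j)) ^ σ)))
      (D * ∑ k ∈ Finset.range m, ∑ j ∈ Finset.range m,
      η ^ dd j k * ((b k ^ r + b j ^ r) * (A + A))) := by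
    refine LIB.const_mul ?_ hD.le
    refine LIB.sum _ fun k => LIB.sum _ fun j => ?_
    refine LIB.const_mul (LIB.const_mul ((hU k).add (hU j)) ?_) (by positivity)
    exact add_nonneg (Real.rpow_nonneg (hb0 k) _) (Real.rpow_nonneg (hb0 j) _)
  have hdouble : D * ∑ k ∈ Finset.range m, ∑ j ∈ Finset.range m,
      η ^ dd j k * ((b k ^ r + b j ^ r) * (A + A)) ≤ E * ∑ k ∈ Finset.range m, b k ^ r := by
    have h := double_sum_bound hη0 hη1 m (fun k => b k ^ r) (fun k => Real.rpow_nonneg (hb0 k) _)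
    have e : ∑ k ∈ Finset.range m, ∑ j ∈ Finset.range m,
      η ^ dd j k * ((b k ^ r + b j ^ r) * (A + A)) = (2 * A) * ∑ k ∈ Finset.range m,
        ∑ j ∈ Finset.range m, η ^ dd j k * (b k ^ r + b j ^ r) := by
      simp_rw [Finset.mul_sum]
      refine Finset.sum_congr rfl fun k _ => Finset.sum_congr rfl fun j _ => ?_
      ring
    rw [e]
    calc _ ≤ D * (2 * A * (2 * (2 / (1 - η)) * ∑ k ∈ Finset.range m, b k ^ r)) := by gcongr
      _ = _ := by rw [hE]; ring
  have hae : ∀ᵐ t ∂μ, t ∈ Icc (0:ℝ) 1 := hμ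
  set X := eLpNorm f (ENNReal.ofReal s) (nuMeas α) with hX
  have hIntg : ∫⁻ t, ‖f t‖ₑ ^ r ∂μ ≤ ENNReal.ofReal (E * K ^ (r / s)) * X ^ r := by
    calc ∫⁻ t, ‖f t‖ₑ ^ r ∂μ ≤ ∫⁻ t, ENNReal.ofReal (D * ∑ k ∈ Finset.range m,
          ∑ j ∈ Finset.range m, η ^ dd j k * ((b k ^ r + b j ^ r) *
          (Λ (st k) ^ (γ * r) * (t ^ Λ (st k)) ^ σ +
            Λ (st j) ^ (γ * r) * (t ^ Λ (st j)) ^ σ))) ∂μ := by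
          refine lintegral_mono_ae ?_
          filter_upwards [hae] with t ht
          rw [← ofReal_norm, ENNReal.ofReal_rpow_of_nonneg (norm_nonneg _) hr0.le]
          refine ENNReal.ofReal_le_ofReal ?_
          refine le_trans ?_ (hpt m b hb0 t ht)
          refine Real.rpow_le_rpow (norm_nonneg _) ?_ hr0.le
          simp_rw [← hPb]
          exact hfb t ht
      _ ≤ _ := hLI.2.2
      _ ≤ ENNReal.ofReal (E * (∑ k ∈ Finset.range m, b k ^ s) ^ (r / s)) := by
          refine ENNReal.ofReal_le_ofReal (hdouble.trans ?_)
          exact mul_le_mul_of_nonneg_left (sum_rpow_le b hb0 hs0 hsr) hE0.le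
      _ = ENNReal.ofReal E * (ENNReal.ofReal (∑ k ∈ Finset.range m, b k ^ s)) ^ (r / s) := by
          rw [ENNReal.ofReal_mul hE0.le, ENNReal.ofReal_rpow_of_nonneg
            (Finset.sum_nonneg fun k _ => Real.rpow_nonneg (hb0 k) _) (by positivity)]
      _ ≤ ENNReal.ofReal E * (ENNReal.ofReal K * X ^ s) ^ (r / s) := by
          gcongr
      _ = _ := by
          rw [ENNReal.mul_rpow_of_nonneg _ _ (by positivity), ← ENNReal.rpow_mul,
            ENNReal.ofReal_rpow_of_nonneg hK.le (by positivity), ENNReal.ofReal_mul hE0.le,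
            mul_assoc]
          congr 3
          field_simp
  have hr' : ENNReal.ofReal r ≠ 0 := by simpa using hr0
  rw [eLpNorm_eq_lintegral_rpow_enorm_toReal hr' ENNReal.ofReal_ne_top,
    ENNReal.toReal_ofReal hr0.le]
  calc (∫⁻ t, ‖f t‖ₑ ^ r ∂μ) ^ (1 / r)
      ≤ (ENNReal.ofReal (E * K ^ (r / s)) * X ^ r) ^ (1 / r) := by gcongr
    _ = _ := by
        rw [ENNReal.mul_rpow_of_nonneg _ _ (by positivity), ← ENNReal.rpow_mul,
          mul_one_div_cancel hr0.ne', ENNReal.rpow_one,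
          ENNReal.ofReal_rpow_of_nonneg (by positivity) (by positivity)]

/-- if the inclusion `ı_μ` is of restricted weak type `p` with a uniform
constant, then it is of strong type `r` for every `r > p`. -/
theorem muntz_inclusion_restricted_weak_implies_strong
    (Λ : ℕ → ℝ) (n : ℕ → ℕ) (N : ℕ) (α β p : ℝ)
    (hQL : IsQuasiLacunary Λ n N) (hα : 0 < α) (hβ : 1 ≤ β) (hp : β ≤ p)
    (μ : MeasureTheory.Measure ℝ) (hμ : μ (Set.Icc (0:ℝ) 1)ᶜ = 0)
    (C : ℝ) (hC : 0 < C)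
    (hw : ∀ k : ℕ, ∀ f ∈ BlockSpace Λ n k, ∀ lam : ℝ, 0 < lam →
      μ {t : ℝ | t ∈ Set.Icc (0:ℝ) 1 ∧ lam < ‖f t‖} ≤
        ENNReal.ofReal (C ^ p * lam⁻¹ ^ p) *
          MeasureTheory.eLpNorm f (ENNReal.ofReal (p / β)) (nuMeas α) ^ p) :
    ∀ r : ℝ, p < r →
      ∃ Cr : ℝ, 0 < Cr ∧ ∀ f ∈ MuntzPoly Λ,
        MeasureTheory.eLpNorm f (ENNReal.ofReal r) μ ≤
          ENNReal.ofReal Cr *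
            MeasureTheory.eLpNorm f (ENNReal.ofReal (r / β)) (nuMeas α) := by
  exact main_aux Λ n N α β p hQL hα hβ hp μ hμ C hC hw
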